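/- Every 2-connected claw-free graph that is not hamiltonian contains an induced subgraph isomorphic to a member of the family 𝒫. -/

import Mathlib

/-- A graph is 2-connected if it has at least 3 vertices and deleting any
single vertex leaves a connected graph. -/
def TwoConnected {V : Type*} [Fintype V] (G : SimpleGraph V) : Prop :=
  3 ≤ Fintype.card V ∧ ∀ v : V, (G.induce ({v}ᶜ : Set V)).Connected

/-- A graph `G` is claw-free if it contains no induced copy of the claw `K_{1,3}`
(center `a`, leaves `b₁, b₂, b₃`). -/
def ClawFree {V : Type*} (G : SimpleGraph V) : Prop :=
  ∀ a b₁ b₂ b₃ : V, b₁ ≠ b₂ → b₁ ≠ b₃ → b₂ ≠ b₃ →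
    G.Adj a b₁ → G.Adj a b₂ → G.Adj a b₃ →
    ¬ (¬ G.Adj b₁ b₂ ∧ ¬ G.Adj b₁ b₃ ∧ ¬ G.Adj b₂ b₃)

/-- The specified adjacencies of a member of Brousek's family `𝒫` with triangles
`a 0, a 1, a 2` and `b 0, b 1, b 2`, where for each `i ∈ Fin 3` the pair `{a i, b i}`
is joined through the `k i ≥ 1` new vertices `c i 0, …, c i (k i - 1)`:
if `t i = true`, then `k i = 1` and `a i, b i, c i 0` form a triangle;
if `t i = false`, then `a i, c i 0, c i 1, …, c i (k i - 1), b i` is a path. -/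
def BrousekSpec {W : Type*} (a b : Fin 3 → W) (t : Fin 3 → Bool) (k : Fin 3 → ℕ)
    (c : Fin 3 → ℕ → W) (x y : W) : Prop :=
  (∃ i j : Fin 3, i ≠ j ∧ x = a i ∧ y = a j) ∨
  (∃ i j : Fin 3, i ≠ j ∧ x = b i ∧ y = b j) ∨
  (∃ i : Fin 3, t i = true ∧ x = a i ∧ y = b i) ∨
  (∃ i : Fin 3, x = a i ∧ y = c i 0) ∨
  (∃ i : Fin 3, ∃ j : ℕ, j + 1 < k i ∧ x = c i j ∧ y = c i (j + 1)) ∨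
  (∃ i : Fin 3, x = c i (k i - 1) ∧ y = b i)

/-- `H` is a member of Brousek's family `𝒫`: its vertices are exactly the (pairwise
distinct) vertices `a 0, a 1, a 2`, `b 0, b 1, b 2` and `c i j` for `i ∈ Fin 3`,
`j < k i`, and its edges are exactly those specified by `BrousekSpec`:
two disjoint triangles `a 0 a 1 a 2` and `b 0 b 1 b 2`, where each pair `{a i, b i}`
is joined either by a triangle `a i b i (c i 0)` (when `t i = true`, with `k i = 1`)
or by a path `a i, c i 0, …, c i (k i - 1), b i` on `k i + 2 ≥ 3` vertices
(when `t i = false`). -/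
def IsBrousekMember {W : Type*} (H : SimpleGraph W) : Prop :=
  ∃ (a b : Fin 3 → W) (t : Fin 3 → Bool) (k : Fin 3 → ℕ) (c : Fin 3 → ℕ → W),
    (∀ i, 1 ≤ k i) ∧
    (∀ i, t i = true → k i = 1) ∧
    Function.Bijective (fun x : (Fin 3 ⊕ Fin 3) ⊕ (Σ i : Fin 3, Fin (k i)) =>
      match x with
      | .inl (.inl i) => a i
      | .inl (.inr i) => b i
      | .inr ⟨i, j⟩ => c i j.val) ∧
    (∀ x y : W, H.Adj x y ↔ (BrousekSpec a b t k c x y ∨ BrousekSpec a b t k c y x))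

set_option linter.unusedSectionVars false

section Paths

variable {V : Type*} [DecidableEq V] {G : SimpleGraph V}

/-- `SpanPath G S a b`: the graph `G` has a path from `a` to `b` whose vertex set is `S`. -/
inductive SpanPath (G : SimpleGraph V) : Finset V → V → V → Prop
  | single (a : V) : SpanPath G {a} a a
  | cons {S : Finset V} {a b x : V} : x ∉ S → G.Adj x a → SpanPath G S a b →
      SpanPath G (insert x S) x b

/-- `SpanCycle G S`: the graph `G` has a cycle whose vertex set is `S`. -/
def SpanCycle (G : SimpleGraph V) (S : Finset V) : Prop :=
  3 ≤ S.card ∧ ∃ a b, SpanPath G S a b ∧ G.Adj b a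

namespace SpanPath

theorem left_mem {S : Finset V} {a b : V} (h : SpanPath G S a b) : a ∈ S := by
  cases h <;> simp

theorem right_mem {S : Finset V} {a b : V} (h : SpanPath G S a b) : b ∈ S := by
  induction h with
  | single => simp
  | cons _ _ _ ih => simp [ih]

theorem append {S T : Finset V} {a b c d : V} (h : SpanPath G S a b) (h' : SpanPath G T c d)
    (hd : Disjoint S T) (hbc : G.Adj b c) : SpanPath G (S ∪ T) a d := by
  induction h with
  | single a => exact .cons (by simpa using hd) hbc h'
  | cons hx ha _ ih =>
    rw [Finset.disjoint_insert_left] at hd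
    rw [Finset.insert_union]
    exact .cons (by simp [hx, hd.1]) ha (ih hd.2 hbc)

theorem concat {S : Finset V} {a b x : V} (h : SpanPath G S a b) (hx : x ∉ S)
    (hbx : G.Adj b x) : SpanPath G (insert x S) a x := by
  have := h.append (.single x) (by simpa using hx) hbx
  rwa [Finset.union_comm, ← Finset.insert_eq] at this

theorem symm {S : Finset V} {a b : V} (h : SpanPath G S a b) : SpanPath G S b a := by
  induction h with
  | single a => exact .single a
  | cons hx ha _ ih => exact ih.concat hx ha.symm

theorem mono {G' : SimpleGraph V} (hG : G ≤ G') {S : Finset V} {a b : V}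
    (h : SpanPath G S a b) : SpanPath G' S a b := by
  induction h with
  | single a => exact .single a
  | cons hx ha _ ih => exact .cons hx (hG ha) ih

theorem map {W : Type*} [DecidableEq W] {H : SimpleGraph W} (e : W ↪ V)
    (he : ∀ x y, H.Adj x y → G.Adj (e x) (e y)) {S : Finset W} {a b : W}
    (h : SpanPath H S a b) : SpanPath G (S.map e) (e a) (e b) := by
  induction h with
  | single a => simpa using SpanPath.single (G := G) (e a)
  | cons hx ha _ ih =>
    rw [Finset.map_insert]
    exact .cons (by simpa using hx) (he _ _ ha) ih

theorem eq_singleton {S : Finset V} {a : V} (h : SpanPath G S a a) : S = {a} := by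
  cases h with
  | single => rfl
  | cons hx _ h => exact absurd h.right_mem hx

/-- A spanning path either is trivial or has a second vertex. -/
theorem eq_or_cons {S : Finset V} {a b : V} (h : SpanPath G S a b) :
    (S = {a} ∧ a = b) ∨ ∃ a', G.Adj a a' ∧ SpanPath G (S.erase a) a' b := by
  cases h with
  | single => simp
  | cons hx ha h => exact .inr ⟨_, ha, by rwa [Finset.erase_insert hx]⟩

theorem eq_or_concat {S : Finset V} {a b : V} (h : SpanPath G S a b) :
    (S = {b} ∧ a = b) ∨ ∃ b', G.Adj b' b ∧ SpanPath G (S.erase b) a b' := by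
  rcases h.symm.eq_or_cons with ⟨h1, h2⟩ | ⟨b', h1, h2⟩
  · exact .inl ⟨h1, h2.symm⟩
  · exact .inr ⟨b', h1.symm, h2.symm⟩

theorem split {S : Finset V} {a b x : V} (h : SpanPath G S a b) (hx : x ∈ S) :
    ∃ S₁ S₂, S = S₁ ∪ S₂ ∧ Disjoint S₁ S₂ ∧ SpanPath G S₁ a x ∧
      ((S₂ = ∅ ∧ x = b) ∨ ∃ y, G.Adj x y ∧ SpanPath G S₂ y b) := by
  induction h with
  | single a =>
    obtain rfl : x = a := by simpa using hx
    exact ⟨{x}, ∅, by simp, by simp, .single x, .inl ⟨rfl, rfl⟩⟩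
  | @cons S a b y hy ha h ih =>
    by_cases hxy : x = y
    · subst hxy
      exact ⟨{x}, S, Finset.insert_eq _ _, by simpa using hy, .single x, .inr ⟨a, ha, h⟩⟩
    · obtain ⟨S₁, S₂, rfl, hd, h₁, h₂⟩ := ih (by simpa [hxy] using hx)
      refine ⟨insert y S₁, S₂, by simp, ?_, .cons (by simp_all) ha h₁, h₂⟩
      rw [Finset.disjoint_insert_left]
      exact ⟨by simp_all, hd⟩

/-- A set of vertices of a spanning path that contains the first vertex and is closed under
adjacency contains all of it. -/
theorem subset_of_closed {S : Finset V} {a b : V} (h : SpanPath G S a b) {D : Set V}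
    (ha : a ∈ D) (hD : ∀ x ∈ D, ∀ y ∈ S, G.Adj x y → y ∈ D) : ∀ x ∈ S, x ∈ D := by
  induction h with
  | single => simpa using ha
  | cons hx hxa h ih =>
    intro y hy
    have ha' := hD _ ha _ (Finset.mem_insert_of_mem h.left_mem) hxa
    rcases Finset.mem_insert.1 hy with rfl | hy
    · exact ha
    · exact ih ha' (fun x hx y hy => hD x hx y (Finset.mem_insert_of_mem hy)) y hy

/-- Two paths sharing only one end can be joined there. -/
theorem join {S T : Finset V} {a b c : V} (h : SpanPath G S a b) (h' : SpanPath G T b c)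
    (hST : ∀ x ∈ S, x ∈ T → x = b) : SpanPath G (S ∪ T) a c := by
  rcases h.eq_or_concat with ⟨rfl, rfl⟩ | ⟨b', hb, h⟩
  · rwa [Finset.union_eq_right.2 (by simpa using h'.left_mem)]
  · have : S ∪ T = S.erase b ∪ T := by
      ext x
      by_cases hx : x = b
      · simp [hx, h'.left_mem]
      · simp [hx]
    rw [this]
    refine h.append h' ?_ hb
    rw [Finset.disjoint_left]
    exact fun x hx hx' => (Finset.mem_erase.1 hx).1 (hST x (Finset.mem_erase.1 hx).2 hx')

/-- Either a path of `G` avoids a given set of edges, or it can be cut at one of them. -/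
theorem deleteEdges_or_split {G' : SimpleGraph V} {S : Finset V} {a b : V}
    (h : SpanPath G S a b) : SpanPath G' S a b ∨ ∃ S₁ S₂ x y, S = S₁ ∪ S₂ ∧ Disjoint S₁ S₂ ∧
      SpanPath G S₁ a x ∧ SpanPath G S₂ y b ∧ G.Adj x y ∧ ¬ G'.Adj x y := by
  induction h with
  | single a => exact .inl (.single a)
  | @cons S a b z hz ha h ih =>
    by_cases hza : G'.Adj z a
    · rcases ih with ih | ⟨S₁, S₂, x, y, rfl, hd, h₁, h₂, hxy⟩
      · exact .inl (.cons hz hza ih)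
      · refine .inr ⟨insert z S₁, S₂, x, y, by simp, ?_, .cons (by simp_all) ha h₁, h₂, hxy⟩
        rw [Finset.disjoint_insert_left]
        exact ⟨by simp_all, hd⟩
    · exact .inr ⟨{z}, S, z, a, Finset.insert_eq _ _, by simpa using hz, .single z, h, ha, hza⟩

theorem of_fun {f : ℕ → V} {n : ℕ} (hadj : ∀ i < n, G.Adj (f i) (f (i + 1)))
    (hinj : ∀ i ≤ n, ∀ j ≤ n, f i = f j → i = j) :
    SpanPath G ((Finset.range (n + 1)).image f) (f 0) (f n) := by
  induction n with
  | zero => simpa using SpanPath.single (G := G) (f 0)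
  | succ n ih =>
    rw [Finset.range_add_one, Finset.image_insert]
    refine (ih (fun i hi => hadj i (by omega))
      (fun i hi j hj => hinj i (by omega) j (by omega))).concat ?_ (hadj n (by omega))
    simp only [Finset.mem_image, Finset.mem_range, not_exists, not_and]
    intro i hi h
    have := hinj i (by omega) (n + 1) le_rfl h
    omega

end SpanPath

namespace SpanCycle

theorem rotate {S : Finset V} (h : SpanCycle G S) {x : V} (hx : x ∈ S) :
    ∃ y z, y ≠ z ∧ G.Adj x y ∧ G.Adj x z ∧ SpanPath G (S.erase x) y z := by
  obtain ⟨hc, a, b, h, hba⟩ := h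
  have main : ∃ y z, G.Adj x y ∧ G.Adj x z ∧ SpanPath G (S.erase x) y z := by
    obtain ⟨S₁, S₂, rfl, hd, h₁, h₂⟩ := h.split hx
    have hx₁ := h₁.right_mem
    have hx₂ : x ∉ S₂ := fun h => (Finset.disjoint_left.1 hd hx₁) h
    rcases h₂ with ⟨rfl, rfl⟩ | ⟨y, hxy, h₂⟩
    · rcases h₁.eq_or_concat with ⟨rfl, rfl⟩ | ⟨b', hb', h₁⟩
      · simp at hc
      · exact ⟨a, b', hba, hb'.symm, by simpa using h₁⟩
    · rcases h₁.eq_or_concat with ⟨rfl, rfl⟩ | ⟨b', hb', h₁⟩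
      · exact ⟨y, b, hxy, hba.symm, by simpa [hx₂] using h₂⟩
      · refine ⟨y, b', hxy, hb'.symm, ?_⟩
        rw [Finset.erase_union_distrib, Finset.erase_eq_of_notMem hx₂, Finset.union_comm]
        exact h₂.append h₁ (hd.symm.mono_right (Finset.erase_subset _ _)) hba
  obtain ⟨y, z, hy, hz, hp⟩ := main
  refine ⟨y, z, ?_, hy, hz, hp⟩
  rintro rfl
  have := congrArg Finset.card hp.eq_singleton
  rw [Finset.card_erase_of_mem hx] at this
  simp at this
  omega

theorem of_path {S : Finset V} {x y z : V} (hx : x ∉ S) (hyz : y ≠ z) (hy : G.Adj x y)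
    (hz : G.Adj x z) (h : SpanPath G S y z) : SpanCycle G (insert x S) := by
  refine ⟨?_, x, z, .cons hx hy h, hz.symm⟩
  rw [Finset.card_insert_of_notMem hx]
  have : ({y, z} : Finset V) ⊆ S := by
    simp [Finset.insert_subset_iff, h.left_mem, h.right_mem]
  have := Finset.card_le_card this
  rw [Finset.card_pair hyz] at this
  omega

theorem of_adj {S : Finset V} {a b c : V} (h : SpanPath G S a b) (hba : G.Adj b a) (hc : c ∈ S)
    (hca : c ≠ a) (hcb : c ≠ b) : SpanCycle G S := by
  refine ⟨?_, a, b, h, hba⟩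
  have : ({a, b, c} : Finset V) ⊆ S := by
    simp [Finset.insert_subset_iff, h.left_mem, h.right_mem, hc]
  refine le_trans (le_of_eq ?_) (Finset.card_le_card this)
  rw [Finset.card_eq_three.2 ⟨a, b, c, hba.ne', hca.symm, hcb.symm, rfl⟩]

end SpanCycle

/-- `NoCutVertex G S`: the subgraph of `G` induced by `S` has at least three vertices and remains
connected when any one vertex is deleted. -/
def NoCutVertex (G : SimpleGraph V) (S : Finset V) : Prop :=
  3 ≤ S.card ∧ ∀ v ∈ S, ∀ X : Set V, (∀ a ∈ X, a ∈ S ∧ a ≠ v) → X.Nonempty →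
    (∀ a ∈ X, ∀ b ∈ S, b ≠ v → G.Adj a b → b ∈ X) → ∀ c ∈ S, c ≠ v → c ∈ X

theorem NoCutVertex.insert {S : Finset V} (h : NoCutVertex G S) {q v w : V} (hv : v ∈ S)
    (hw : w ∈ S) (hvw : v ≠ w) (hqv : G.Adj q v) (hqw : G.Adj q w) :
    NoCutVertex G (insert q S) := by
  by_cases hq : q ∈ S
  · rwa [Finset.insert_eq_of_mem hq]
  refine ⟨h.1.trans (Finset.card_le_card (Finset.subset_insert _ _)), ?_⟩
  intro x hx X hX hne hcl
  by_cases hxq : x = q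
  · subst hxq
    have key : ∀ c ∈ S, c ∈ X := by
      intro c hc
      obtain ⟨a, ha⟩ := hne
      have haS : a ∈ S := by simpa [(hX a ha).2] using (hX a ha).1
      have hne' : ∀ y ∈ S, y ≠ x := fun y hy h => hq (h ▸ hy)
      -- delete one of `v`, `w`, and then use the other one
      by_contra hcX
      obtain ⟨d, hdS, hda, hdc⟩ : ∃ d ∈ S, d ≠ a ∧ d ≠ c := by
        by_contra! hcon
        have : S ⊆ {a, c} := by
          intro d hd
          by_cases hda : d = a
          · simp [hda]
          · simp [hcon d hd hda]
        have := Finset.card_le_card this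
        have := Finset.card_le_two (a := a) (b := c)
        have := h.1
        omega
      have := h.2 d hdS {y | y ∈ X ∧ y ≠ d} (fun y hy => ⟨by
        simpa [(hX y hy.1).2] using (hX y hy.1).1, hy.2⟩) ⟨a, ha, hda.symm⟩
        (fun y hy z hz hzd hyz => ⟨hcl y hy.1 z (by simp [hz]) (hne' z hz) hyz, hzd⟩)
        c hc hdc.symm
      exact hcX this.1
    intro c hc hcx
    exact key c (by simpa [hcx] using hc)
  · have hxS : x ∈ S := by simpa [hxq] using hx
    obtain ⟨y, hyS, hyx, hqy⟩ : ∃ y ∈ S, y ≠ x ∧ G.Adj q y := by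
      by_cases hvx : v = x
      · exact ⟨w, hw, fun h => hvw (hvx.trans h.symm), hqw⟩
      · exact ⟨v, hv, hvx, hqv⟩
    have hne' : ∃ a ∈ X, a ∈ S := by
      obtain ⟨a, ha⟩ := hne
      by_cases haq : a = q
      · exact ⟨y, hcl a ha y (by simp [hyS]) hyx (haq ▸ hqy), hyS⟩
      · exact ⟨a, ha, by simpa [haq] using (hX a ha).1⟩
    obtain ⟨a, ha, haS⟩ := hne'
    have key := h.2 x hxS {y | y ∈ X ∧ y ∈ S} (fun b hb => ⟨hb.2, (hX b hb.1).2⟩) ⟨a, ha, haS⟩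
      (fun b hb c hc hcx hbc => ⟨hcl b hb.1 c (by simp [hc]) hcx hbc, hc⟩)
    intro c hc hcx
    rcases Finset.mem_insert.1 hc with rfl | hc
    · exact hcl y (key y hyS hyx).1 c (by simp) hcx hqy.symm
    · exact (key c hc hcx).1

theorem SpanCycle.noCutVertex {S : Finset V} (h : SpanCycle G S) : NoCutVertex G S := by
  refine ⟨h.1, fun v hv X hX ⟨a, ha⟩ hcl c hc hcv => ?_⟩
  obtain ⟨y, z, -, -, -, hp⟩ := h.rotate hv
  -- everything on the path is in `X`, by starting from `a` in both directions
  obtain ⟨S₁, S₂, hS, hd, h₁, h₂⟩ := hp.split (x := a) (by simp [hX a ha])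
  have hsub : ∀ x ∈ S₁ ∪ S₂, x ∈ S ∧ x ≠ v := by
    intro x hx
    rw [← hS] at hx
    exact ⟨Finset.mem_of_mem_erase hx, Finset.ne_of_mem_erase hx⟩
  have hc' : c ∈ S₁ ∪ S₂ := by rw [← hS]; simp [hc, hcv]
  have hcl' : ∀ a ∈ X, ∀ b ∈ S₁ ∪ S₂, G.Adj a b → b ∈ X := fun a ha b hb =>
    hcl a ha b (hsub b hb).1 (hsub b hb).2
  rcases Finset.mem_union.1 hc' with hc' | hc'
  · exact h₁.symm.subset_of_closed ha
      (fun x hx y hy => hcl' x hx y (Finset.mem_union_left _ hy)) c hc'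
  · rcases h₂ with ⟨rfl, -⟩ | ⟨y, hay, h₂⟩
    · simp at hc'
    · exact h₂.subset_of_closed (hcl' a ha y (Finset.mem_union_right _ h₂.left_mem) hay)
        (fun x hx y hy => hcl' x hx y (Finset.mem_union_right _ hy)) c hc'

end Paths

/-- A shortest path in `G[S]` from `A` to `B`; the hypothesis says that `B` meets every subset of
`S` that contains `A` and is closed under adjacency. -/
theorem exists_shortest_path {V : Type*} (G : SimpleGraph V) (S A B : Set V)
    (h : ∀ D ⊆ S, A ∩ S ⊆ D → (∀ a ∈ D, ∀ b ∈ S, G.Adj a b → b ∈ D) → (D ∩ B).Nonempty) :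
    ∃ (f : ℕ → V) (n : ℕ), f 0 ∈ A ∧ f n ∈ B ∧ (∀ i ≤ n, f i ∈ S) ∧
      (∀ i ≤ n, f i ∈ A → i = 0) ∧ (∀ i ≤ n, f i ∈ B → i = n) ∧
      (∀ i ≤ n, ∀ j ≤ n, f i = f j → i = j) ∧
      (∀ i ≤ n, ∀ j ≤ n, G.Adj (f i) (f j) ↔ i + 1 = j ∨ j + 1 = i) := by
  let P : ℕ → Prop := fun n => ∃ f : ℕ → V, f 0 ∈ A ∧ f n ∈ B ∧ (∀ i ≤ n, f i ∈ S) ∧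
    ∀ i < n, G.Adj (f i) (f (i + 1))
  have hex : ∃ n, P n := by
    let D : Set V := {x | ∃ (n : ℕ) (f : ℕ → V), f 0 ∈ A ∧ f n = x ∧ (∀ i ≤ n, f i ∈ S) ∧
      ∀ i < n, G.Adj (f i) (f (i + 1))}
    obtain ⟨x, ⟨n, f, h0, rfl, hS, hadj⟩, hx⟩ := h D
      (by rintro x ⟨n, f, h0, rfl, hS, hadj⟩; exact hS n le_rfl)
      (fun x hx => ⟨0, fun _ => x, hx.1, rfl, fun _ _ => hx.2, fun i hi => absurd hi (by omega)⟩)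
      (by
        rintro x ⟨n, f, h0, rfl, hS, hadj⟩ y hy hxy
        refine ⟨n + 1, fun i => if i ≤ n then f i else y, by simpa, by simp, ?_, ?_⟩
        · intro i hi
          by_cases hin : i ≤ n
          · simp [hin, hS i hin]
          · simp [hin, hy]
        · intro i hi
          by_cases hin : i + 1 ≤ n
          · simp [hin, show i ≤ n by omega, hadj i (by omega)]
          · obtain rfl : i = n := by omega
            simpa using hxy)
    exact ⟨n, f, h0, hx, hS, hadj⟩
  classical
  obtain ⟨f, h0, hn, hS, hadj⟩ := Nat.find_spec hex
  set n := Nat.find hex with hnd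
  have hmin : ∀ m < n, ¬ P m := fun m hm => Nat.find_min hex hm
  -- jumping from position `i` to position `j` cannot shorten the path
  have hjump : ∀ i j, i < j → j ≤ n → G.Adj (f i) (f j) → j = i + 1 := by
    intro i j hij hj hadj'
    by_contra hne
    apply hmin (n - (j - i - 1)) (by omega)
    refine ⟨fun t => if t ≤ i then f t else f (t + (j - i - 1)), by simpa, ?_, ?_, ?_⟩
    · dsimp only
      rw [if_neg (by omega)]
      convert hn using 2
      omega
    · intro t ht
      dsimp only
      split_ifs
      · exact hS t (by omega)
      · exact hS _ (by omega)
    · intro t ht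
      dsimp only
      by_cases h1 : t + 1 ≤ i
      · rw [if_pos (by omega), if_pos h1]
        exact hadj t (by omega)
      · by_cases h2 : t ≤ i
        · obtain rfl : t = i := by omega
          rw [if_pos le_rfl, if_neg h1]
          convert hadj' using 2
          omega
        · rw [if_neg h2, if_neg h1]
          convert hadj (t + (j - i - 1)) (by omega) using 2
          omega
  have hinj : ∀ i j, i < j → j ≤ n → f i ≠ f j := by
    intro i j hij hj heq
    by_cases hjn : j = n
    · subst hjn
      exact hmin i hij ⟨f, h0, heq ▸ hn, fun t ht => hS t (by omega), fun t ht => hadj t (by omega)⟩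
    · have := hjump i (j + 1) (by omega) (by omega) (heq ▸ hadj j (by omega))
      omega
  refine ⟨f, n, h0, hn, hS, ?_, ?_, ?_, ?_⟩
  · intro i hi hiA
    by_contra hi0
    exact hmin (n - i) (by omega) ⟨fun t => f (t + i), by simpa using hiA,
      by simpa [Nat.sub_add_cancel hi] using hn, fun t ht => hS _ (by omega),
      fun t ht => by simpa [add_right_comm] using hadj (t + i) (by omega)⟩
  · intro i hi hiB
    by_contra hi0
    exact hmin i (by omega) ⟨f, h0, hiB, fun t ht => hS _ (by omega), fun t ht => hadj t (by omega)⟩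
  · intro i hi j hj heq
    rcases lt_trichotomy i j with hij | hij | hij
    · exact absurd heq (hinj i j hij hj)
    · exact hij
    · exact absurd heq.symm (hinj j i hij hi)
  · intro i hi j hj
    constructor
    · intro hadj'
      rcases lt_trichotomy i j with hij | hij | hij
      · exact .inl (hjump i j hij hj hadj').symm
      · exact absurd hadj' (hij ▸ G.irrefl)
      · exact .inr (hjump j i hij hi hadj'.symm).symm
    · rintro (rfl | rfl)
      · exact hadj i (by omega)
      · exact (hadj j (by omega)).symm

theorem ClawFree.adj_of_not_adj {V : Type*} {G : SimpleGraph V} (hG : ClawFree G)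
    {a b c d : V} (hbc : b ≠ c) (hbd : b ≠ d)
    (hcd : c ≠ d) (hb : G.Adj a b) (hc : G.Adj a c) (hd : G.Adj a d) (hnc : ¬ G.Adj b c)
    (hnd : ¬ G.Adj b d) : G.Adj c d := by
  by_contra h
  exact hG a b c d hbc hbd hcd hb hc hd ⟨hnc, hnd, h⟩

section Minimal

variable {V : Type*} [DecidableEq V] {G : SimpleGraph V}

/-- One more neighbour `z` of `q` can be added to two disjoint paths inside the neighbourhood
of `q`, keeping their first vertices. -/
theorem ClawFree.extend_two_paths (hG : ClawFree G) {q v w p r z : V} {A B : Finset V}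
    (hA : SpanPath G A v p) (hB : SpanPath G B w r) (hd : Disjoint A B) (hzA : z ∉ A) (hzB : z ∉ B)
    (hqA : ∀ x ∈ A, G.Adj q x) (hqB : ∀ x ∈ B, G.Adj q x) (hqz : G.Adj q z) (hzv : G.Adj z v) :
    ∃ A' B' p' r', A' ∪ B' = insert z (A ∪ B) ∧ Disjoint A' B' ∧ SpanPath G A' v p' ∧
      SpanPath G B' w r' := by
  by_cases hzp : G.Adj p z
  · exact ⟨insert z A, B, z, r, by simp, by simp [hzB, hd], hA.concat hzA hzp, hB⟩
  by_cases hzr : G.Adj r z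
  · exact ⟨A, insert z B, p, z, by simp, by simp [hzA, hd], hA, hB.concat hzB hzr⟩
  have hpr : G.Adj p r := hG.adj_of_not_adj (ne_of_mem_of_not_mem hA.right_mem hzA).symm
    (ne_of_mem_of_not_mem hB.right_mem hzB).symm
    (fun h => Finset.disjoint_left.1 hd hA.right_mem (h ▸ hB.right_mem)) hqz
    (hqA p hA.right_mem) (hqB r hB.right_mem) (fun h => hzp h.symm) (fun h => hzr h.symm)
  rcases hA.eq_or_cons with ⟨-, rfl⟩ | ⟨v', hv', hA'⟩
  · exact absurd hzv.symm hzp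
  · refine ⟨{v, z}, B ∪ A.erase v, z, v', ?_, ?_, ?_, ?_⟩
    · have := hA.left_mem
      ext x
      by_cases hx : x = v <;> simp [hx, this]
      tauto
    · rw [Finset.disjoint_left]
      intro x hx
      simp only [Finset.mem_insert, Finset.mem_singleton] at hx
      rcases hx with rfl | rfl
      · simpa using Finset.disjoint_left.1 hd hA.left_mem
      · simp [hzA, hzB]
    · have hvz : v ∉ ({z} : Finset V) := by simpa using hzv.ne'
      exact .cons hvz hzv.symm (.single z)
    · exact hB.append hA'.symm (hd.symm.mono_right (Finset.erase_subset _ _)) hpr.symm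

/-- The neighbours of `q` can be covered by two disjoint paths with prescribed first vertices `v`
and `w`, if every other neighbour is adjacent to `v` or `w`. -/
theorem ClawFree.exists_two_paths (hG : ClawFree G) {q v w : V} (hvw : v ≠ w) (hqv : G.Adj q v)
    (hqw : G.Adj q w) (T : Finset V) (hv : v ∉ T) (hw : w ∉ T) (hqT : ∀ z ∈ T, G.Adj q z)
    (hT : ∀ z ∈ T, G.Adj z v ∨ G.Adj z w) :
    ∃ A B p r, A ∪ B = insert v (insert w T) ∧ Disjoint A B ∧ SpanPath G A v p ∧
      SpanPath G B w r := by
  induction T using Finset.induction_on with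
  | empty => exact ⟨{v}, {w}, v, w, rfl, by simpa using hvw, .single v, .single w⟩
  | insert z T hz ih =>
    simp only [Finset.mem_insert, not_or, forall_eq_or_imp] at hv hw hqT hT
    obtain ⟨A, B, p, r, hAB, hd, hA, hB⟩ := ih hv.2 hw.2 hqT.2 hT.2
    have hq : ∀ x ∈ A ∪ B, G.Adj q x := by
      intro x hx
      rw [hAB] at hx
      simp only [Finset.mem_insert] at hx
      rcases hx with rfl | rfl | hx
      exacts [hqv, hqw, hqT.2 x hx]
    have hzAB : z ∉ A ∪ B := by
      rw [hAB]
      simp [hz, Ne.symm hv.1, Ne.symm hw.1]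
    simp only [Finset.mem_union, not_or] at hzAB
    have hU : insert v (insert w (insert z T)) = insert z (A ∪ B) := by
      rw [hAB]
      ext x
      simp only [Finset.mem_insert]
      tauto
    rw [hU]
    rcases hT.1 with hzv | hzw
    · exact hG.extend_two_paths hA hB hd hzAB.1 hzAB.2 (fun x hx => hq x (by simp [hx]))
        (fun x hx => hq x (by simp [hx])) hqT.1 hzv
    · obtain ⟨B', A', r', p', h1, h2, h3, h4⟩ := hG.extend_two_paths hB hA hd.symm hzAB.2 hzAB.1
        (fun x hx => hq x (by simp [hx])) (fun x hx => hq x (by simp [hx])) hqT.1 hzw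
      exact ⟨A', B', p', r', by rw [Finset.union_comm, h1, Finset.union_comm], h2.symm, h4, h3⟩

/-- If some vertex `q` can be deleted from a Hamilton cycle, every edge of which meets the
non-neighbours of `q`, then so can any set of neighbours of `q`, as long as one is kept. -/
theorem ClawFree.spanCycle_sdiff (hG : ClawFree G) {q : V} {S : Finset V} (hqS : q ∉ S)
    {G' : SimpleGraph V} (hG' : ∀ x y, G'.Adj x y ↔ G.Adj x y ∧ ¬ (G.Adj q x ∧ G.Adj q y))
    (hS : SpanCycle G' S) {v : V} (hv : v ∈ S) (hqv : G.Adj q v) (T : Finset V) (hvT : v ∉ T)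
    (hTS : T ⊆ S) (hT : ∀ z ∈ T, G.Adj q z) : SpanCycle G' (S \ T) := by
  induction T using Finset.induction_on with
  | empty => simpa using hS
  | insert t T ht ih =>
    simp only [Finset.mem_insert, not_or, forall_eq_or_imp, Finset.insert_subset_iff] at hvT hT hTS
    have hC := ih hvT.2 hTS.2 hT.2
    have htm : t ∈ S \ T := by simp [hTS.1, ht]
    obtain ⟨y, z, hyz, hty, htz, hp⟩ := hC.rotate htm
    rw [hG'] at hty htz
    have hqy : ¬ G.Adj q y := fun h => hty.2 ⟨hT.1, h⟩
    have hqz : ¬ G.Adj q z := fun h => htz.2 ⟨hT.1, h⟩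
    have hmem : ∀ x ∈ (S \ T).erase t, x ≠ q := by
      rintro x hx rfl
      simp [hqS] at hx
    have hadj : G.Adj y z := hG.adj_of_not_adj (a := t) (b := q) (hmem y hp.left_mem).symm
      (hmem z hp.right_mem).symm hyz hT.1.symm hty.1 htz.1 hqy hqz
    have heq : S \ insert t T = (S \ T).erase t := by
      rw [Finset.sdiff_insert]
    rw [heq]
    refine SpanCycle.of_adj hp ((hG' _ _).2 ⟨hadj.symm, fun h => hqz h.1⟩) (c := v) ?_ ?_ ?_
    · simp [hvT, hv]
    · rintro rfl; exact hqy hqv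
    · rintro rfl; exact hqz hqv

variable [Fintype V]

/-- A 2-connected claw-free non-hamiltonian graph all of whose proper 2-connected induced subgraphs
are hamiltonian. -/
structure IsMinimalNonhamiltonian (G : SimpleGraph V) : Prop where
  clawFree : ClawFree G
  noCutVertex : NoCutVertex G Finset.univ
  not_spanCycle : ¬ SpanCycle G Finset.univ
  spanCycle_of_ne : ∀ S, S ≠ Finset.univ → NoCutVertex G S → SpanCycle G S

namespace IsMinimalNonhamiltonian

theorem false_of_spanPath (hG : IsMinimalNonhamiltonian G) {S : Finset V} {x y : V}
    (hS : SpanPath G S x y) (h : ∀ z, z ∈ S) (hyx : G.Adj y x) : False := by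
  obtain rfl : S = Finset.univ := by simpa [Finset.ext_iff] using h
  exact hG.not_spanCycle ⟨hG.noCutVertex.1, x, y, hS, hyx⟩

/-- A vertex whose deletion leaves a 2-connected graph has at most two neighbours. -/
theorem not_three_adj (hG : IsMinimalNonhamiltonian G) {q : V}
    (hq : NoCutVertex G (Finset.univ.erase q)) {r s t : V} (hrs : r ≠ s) (hrt : r ≠ t)
    (hst : s ≠ t) (hr : G.Adj q r) (hs : G.Adj q s) (ht : G.Adj q t) : False := by
  classical
  have hC := hG.spanCycle_of_ne _ (by simp [Finset.ext_iff]) hq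
  let G' : SimpleGraph V :=
    { Adj := fun x y => G.Adj x y ∧ ¬ (G.Adj q x ∧ G.Adj q y)
      symm := ⟨fun x y h => ⟨h.1.symm, fun h' => h.2 h'.symm⟩⟩
      loopless := ⟨fun x h => G.irrefl h.1⟩ }
  have hG' : ∀ x y, G'.Adj x y ↔ G.Adj x y ∧ ¬ (G.Adj q x ∧ G.Adj q y) := fun _ _ => Iff.rfl
  have hle : G' ≤ G := fun x y h => h.1
  -- the cycle uses no edge between two neighbours of `q`
  have hC' : SpanCycle G' (Finset.univ.erase q) := by
    obtain ⟨y, z, hyz, hry, hrz, hp⟩ := hC.rotate (x := r) (by simp [hr.ne'])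
    have hqy : ¬ G.Adj q y := fun hqy =>
      hG.false_of_spanPath ((hp.symm.concat (by simp) hqy.symm).concat (by simp [hr.ne']) hr)
        (by intro x; by_cases x = r <;> by_cases x = q <;> simp_all) hrz
    have hqz : ¬ G.Adj q z := fun hqz =>
      hG.false_of_spanPath ((hp.concat (by simp) hqz.symm).concat (by simp [hr.ne']) hr)
        (by intro x; by_cases x = r <;> by_cases x = q <;> simp_all) hry
    rcases hp.deleteEdges_or_split (G' := G') with hp' | ⟨S₁, S₂, x, x', hS, hd, h₁, h₂, hx, hx'⟩
    · rw [← Finset.insert_erase (a := r) (s := Finset.univ.erase q) (by simp [hr.ne'])]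
      exact .of_path (Finset.notMem_erase _ _) hyz ((hG' _ _).2 ⟨hry, fun h => hqy h.2⟩)
        ((hG' _ _).2 ⟨hrz, fun h => hqz h.2⟩) hp'
    · exfalso
      rw [hG'] at hx'
      push Not at hx'
      obtain ⟨hqx, hqx'⟩ := hx' hx
      have hmem : ∀ a, a ∈ S₁ ∪ S₂ ↔ a ≠ r ∧ a ≠ q := by
        intro a
        rw [← hS]
        simp
      have hq₁ : q ∉ S₁ ∪ S₂ := by simp [hmem]
      have hr₁ : r ∉ S₁ ∪ S₂ := by simp [hmem]
      simp only [Finset.mem_union, not_or] at hq₁ hr₁ hmem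
      refine hG.false_of_spanPath (((h₁.concat hq₁.1 hqx.symm).append h₂
        (by simp [hq₁.2, hd]) hqx').concat (x := r) (by simp [hr₁, hr.ne']) hrz.symm) ?_ hry
      intro a
      have := hmem a
      simp only [Finset.mem_insert, Finset.mem_union]
      tauto
  obtain ⟨v, w, hvw, hqv, hqw, hvwU⟩ : ∃ v w, v ≠ w ∧ G.Adj q v ∧ G.Adj q w ∧
      ∀ z, G.Adj q z → z ≠ v → z ≠ w → G.Adj z v ∨ G.Adj z w := by
    by_cases h : ∃ v w, v ≠ w ∧ G.Adj q v ∧ G.Adj q w ∧ ¬ G.Adj v w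
    · obtain ⟨v, w, hvw, hqv, hqw, hn⟩ := h
      refine ⟨v, w, hvw, hqv, hqw, fun z hz hzv hzw => ?_⟩
      by_cases hvz : G.Adj v z
      · exact .inl hvz.symm
      · exact .inr (hG.clawFree.adj_of_not_adj hzv.symm hvw hzw hqv hz hqw hvz hn)
    · push Not at h
      exact ⟨r, s, hrs, hr, hs, fun z hz hzr _ => .inl (h z r hzr hz hr)⟩
  set T : Finset V := Finset.univ.filter fun z => G.Adj q z ∧ z ≠ v ∧ z ≠ w with hTdef
  have hT : ∀ z, z ∈ T ↔ G.Adj q z ∧ z ≠ v ∧ z ≠ w := by simp [hTdef]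
  have hC₂ : SpanCycle G' (Finset.univ.erase q \ T) :=
    hG.clawFree.spanCycle_sdiff (by simp) hG' hC' (v := v) (by simp [hqv.ne']) hqv T (by simp [hT])
      (fun z hz => by simpa using ((hT z).1 hz).1.ne') (fun z hz => ((hT z).1 hz).1)
  have hC₃ : SpanCycle G (Finset.univ.erase q \ T) := by
    obtain ⟨h1, a, b, h2, h3⟩ := hC₂
    exact ⟨h1, a, b, h2.mono hle, hle h3⟩
  have hN : NoCutVertex G (insert q (Finset.univ.erase q \ T)) :=
    hC₃.noCutVertex.insert (v := v) (w := w) (by simp [hT, hqv.ne']) (by simp [hT, hqw.ne'])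
      hvw hqv hqw
  have hne : insert q (Finset.univ.erase q \ T) ≠ Finset.univ := by
    obtain ⟨x, hx⟩ : ∃ x, x ∈ T := by
      simp only [hT]
      by_contra! h
      have h1 := h r hr
      have h2 := h s hs
      have h3 := h t ht
      grind
    intro h
    have hx' : x ∈ insert q (Finset.univ.erase q \ T) := by rw [h]; exact Finset.mem_univ x
    rcases Finset.mem_insert.1 hx' with h' | h'
    · exact ((hT x).1 hx).1.ne' h'
    · exact (Finset.mem_sdiff.1 h').2 hx
  obtain ⟨y, z, hyz, hqy, hqz, hp⟩ := (hG.spanCycle_of_ne _ hne hN).rotate (x := q) (by simp)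
  rw [Finset.erase_insert (by simp)] at hp
  have hp' : SpanPath G (Finset.univ.erase q \ T) v w := by
    have hy := hp.left_mem
    have hz := hp.right_mem
    simp only [Finset.mem_sdiff, hT, Finset.mem_erase] at hy hz
    have hy' : y = v ∨ y = w := by tauto
    have hz' : z = v ∨ z = w := by tauto
    rcases hy' with rfl | rfl <;> rcases hz' with rfl | rfl
    · exact absurd rfl hyz
    · exact hp
    · exact hp.symm
    · exact absurd rfl hyz
  obtain ⟨A, B, p, r', hAB, hd, hA, hB⟩ := hG.clawFree.exists_two_paths hvw hqv hqw T
    (by simp [hT]) (by simp [hT]) (fun z hz => ((hT z).1 hz).1)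
    (fun z hz => hvwU z ((hT z).1 hz).1 ((hT z).1 hz).2.1 ((hT z).1 hz).2.2)
  have hmem : ∀ x, x ∈ A ∨ x ∈ B ↔ x = v ∨ x = w ∨ x ∈ T := by
    intro x
    rw [← Finset.mem_union, hAB]
    simp
  have hdis : ∀ x, x ∈ A → x ∉ B := fun x h h' => Finset.disjoint_left.1 hd h h'
  have hqAB : ∀ x, x ∈ A ∨ x ∈ B → G.Adj q x := by
    intro x hx
    rcases (hmem x).1 hx with rfl | rfl | hx
    exacts [hqv, hqw, ((hT x).1 hx).1]
  have hvA := hA.left_mem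
  have hwB := hB.left_mem
  have hall := (hA.symm.join hp' (by
    intro x hx hx'
    rcases (hmem x).1 (.inl hx) with rfl | rfl | hxT
    · rfl
    · exact absurd hwB (hdis _ hx)
    · exact absurd hxT (Finset.mem_sdiff.1 hx').2)).join hB (by
    intro x hx hx'
    have := hdis x
    simp only [Finset.mem_union, Finset.mem_sdiff] at hx
    rcases (hmem x).1 (.inr hx') with rfl | rfl | hx''
    · exact absurd hx' (this hvA)
    · rfl
    · tauto)
  have hqA := hqAB p (.inl hA.right_mem)
  have hqB := hqAB r' (.inr hB.right_mem)
  refine hG.false_of_spanPath (hall.concat (x := q) ?_ hqB.symm) ?_ hqA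
  · simp only [Finset.mem_union, Finset.mem_sdiff, not_or]
    exact ⟨⟨fun h => G.irrefl (hqAB q (.inl h)), by simp⟩, fun h => G.irrefl (hqAB q (.inr h))⟩
  · intro x
    have := hmem x
    simp only [Finset.mem_insert, Finset.mem_union, Finset.mem_sdiff, Finset.mem_erase,
      Finset.mem_univ, and_true]
    tauto

end IsMinimalNonhamiltonian

end Minimal

section Separation

variable {V : Type*} [DecidableEq V] {G : SimpleGraph V}

/-- A path one of whose vertices lies in a set `Z` closed under adjacency away from `v` has an end
in `Z`, and lies in `Z` if it does not contain `v`. -/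
theorem SpanPath.end_mem_of_closed {P : Finset V} {c d p v : V} (hP : SpanPath G P c d) {Z : Set V}
    (hp : p ∈ P) (hpZ : p ∈ Z) (hcl : ∀ a ∈ Z, ∀ b ∈ P, b ≠ v → G.Adj a b → b ∈ Z) :
    c ∈ Z ∨ d ∈ Z := by
  obtain ⟨S₁, S₂, rfl, hd, h₁, h₂⟩ := hP.split hp
  by_cases hv : v ∈ S₁
  · right
    rcases h₂ with ⟨-, rfl⟩ | ⟨y, hy, h₂⟩
    · exact hpZ
    · have hv₂ : ∀ b ∈ S₂, b ≠ v := fun b hb h => Finset.disjoint_left.1 hd hv (h ▸ hb)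
      have hyZ := hcl p hpZ y (by simp [h₂.left_mem]) (hv₂ y h₂.left_mem) hy
      exact h₂.subset_of_closed hyZ (fun x hx y hy h => hcl x hx y (by simp [hy]) (hv₂ y hy) h) _
        h₂.right_mem
  · left
    refine h₁.symm.subset_of_closed hpZ (fun x hx y hy h => hcl x hx y (by simp [hy]) ?_ h) _
        h₁.left_mem
    rintro rfl
    exact hv hy

theorem SpanPath.subset_of_closed_of_notMem {P : Finset V} {c d p v : V} (hP : SpanPath G P c d)
    {Z : Set V} (hp : p ∈ P) (hpZ : p ∈ Z) (hv : v ∉ P)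
    (hcl : ∀ a ∈ Z, ∀ b ∈ P, b ≠ v → G.Adj a b → b ∈ Z) : ∀ x ∈ P, x ∈ Z := by
  have hcl' : ∀ a ∈ Z, ∀ b ∈ P, G.Adj a b → b ∈ Z :=
    fun a ha b hb => hcl a ha b hb (ne_of_mem_of_not_mem hb hv)
  rcases hP.end_mem_of_closed hp hpZ hcl with h | h
  · exact hP.subset_of_closed h hcl'
  · exact hP.symm.subset_of_closed h hcl'

/-- The vertices `x` and `y` separate the nonempty sets `X` and `Y`. -/
structure IsSeparation (G : SimpleGraph V) (x y : V) (X Y : Finset V) : Prop where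
  ne : x ≠ y
  mem : ∀ v, v = x ∨ v = y ∨ v ∈ X ∨ v ∈ Y
  disjoint : Disjoint X Y
  left_notMem_left : x ∉ X
  right_notMem_left : y ∉ X
  left_notMem_right : x ∉ Y
  right_notMem_right : y ∉ Y
  nonempty_left : X.Nonempty
  nonempty_right : Y.Nonempty
  not_adj : ∀ a ∈ X, ∀ b ∈ Y, ¬ G.Adj a b

namespace IsSeparation

variable {x y : V} {X Y : Finset V}

theorem symm (h : IsSeparation G x y X Y) : IsSeparation G x y Y X where
  ne := h.ne
  mem v := by have := h.mem v; tauto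
  disjoint := h.disjoint.symm
  left_notMem_left := h.left_notMem_right
  right_notMem_left := h.right_notMem_right
  left_notMem_right := h.left_notMem_left
  right_notMem_right := h.right_notMem_left
  nonempty_left := h.nonempty_right
  nonempty_right := h.nonempty_left
  not_adj a ha b hb hab := h.not_adj b hb a ha hab.symm

theorem swap (h : IsSeparation G x y X Y) : IsSeparation G y x X Y where
  ne := h.ne.symm
  mem v := by have := h.mem v; tauto
  disjoint := h.disjoint
  left_notMem_left := h.right_notMem_left
  right_notMem_left := h.left_notMem_left
  left_notMem_right := h.right_notMem_right
  right_notMem_right := h.left_notMem_right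
  nonempty_left := h.nonempty_left
  nonempty_right := h.nonempty_right
  not_adj := h.not_adj

variable [Fintype V]

theorem eq_empty_of_closed (h : IsSeparation G x y X Y) (hG : NoCutVertex G Finset.univ)
    {D : Set V} (hD : ∀ a ∈ D, a ∈ Y) (hcl : ∀ a ∈ D, ∀ b ∈ Y, G.Adj a b → b ∈ D)
    (hy : ∀ a ∈ D, ¬ G.Adj a y) : D = ∅ := by
  by_contra hne
  have := hG.2 x (Finset.mem_univ _) D
    (fun a ha => ⟨Finset.mem_univ _, fun hx => h.left_notMem_right (hx ▸ hD a ha)⟩)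
    (Set.nonempty_iff_ne_empty.2 hne) (fun a ha b _ hbx hab => by
      rcases h.mem b with rfl | rfl | hb | hb
      · exact absurd rfl hbx
      · exact absurd hab (hy a ha)
      · exact absurd hab.symm (h.not_adj b hb a (hD a ha))
      · exact hcl a ha b hb hab) y (Finset.mem_univ _) h.ne.symm
  exact h.right_notMem_right (hD y this)

/-- A shortest path between the two separating vertices through one of the sides. -/
theorem exists_path (h : IsSeparation G x y X Y) (hG : NoCutVertex G Finset.univ) :
    ∃ (f : ℕ → V) (n : ℕ), G.Adj x (f 0) ∧ G.Adj y (f n) ∧ (∀ i ≤ n, f i ∈ Y) ∧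
      (∀ i ≤ n, G.Adj x (f i) → i = 0) ∧ (∀ i ≤ n, G.Adj y (f i) → i = n) ∧
      (∀ i ≤ n, ∀ j ≤ n, f i = f j → i = j) ∧
      (∀ i ≤ n, ∀ j ≤ n, G.Adj (f i) (f j) ↔ i + 1 = j ∨ j + 1 = i) := by
  refine exists_shortest_path G Y {v | G.Adj x v} {v | G.Adj y v} fun D hDY hxD hD => ?_
  by_contra hne
  rw [Set.not_nonempty_iff_eq_empty] at hne
  have hDe := h.eq_empty_of_closed hG (D := D) (fun a ha => hDY ha) (fun a ha b hb => hD a ha b hb)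
    (fun a ha hay => by
      have : a ∈ D ∩ {v | G.Adj y v} := ⟨ha, hay.symm⟩
      simp [hne] at this)
  have := h.swap.eq_empty_of_closed hG (D := Y) (fun a ha => ha) (fun a _ b hb _ => hb)
    (fun a ha hax => by
      have : a ∈ D := hxD ⟨hax.symm, ha⟩
      simp [hDe] at this)
  exact h.nonempty_right.ne_empty (by exact_mod_cast this)

theorem noCutVertex_aux₁ (h : IsSeparation G x y X Y) (hG : NoCutVertex G Finset.univ)
    {P : Finset V} {c d : V} (hPX : P ⊆ X) (hP : SpanPath G P c d) (hxc : G.Adj x c)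
    (hyd : G.Adj y d) {v : V} {Z : Set V}
    (hZ : ∀ a ∈ Z, a ∈ insert x (insert y (Y ∪ P)) ∧ a ≠ v) (hne : Z.Nonempty)
    (hcl : ∀ a ∈ Z, ∀ b ∈ insert x (insert y (Y ∪ P)), b ≠ v → G.Adj a b → b ∈ Z) :
    x ∈ Z ∨ y ∈ Z := by
  by_contra! hn
  obtain ⟨hx, hy⟩ := hn
  have hclP : ∀ a ∈ Z, ∀ b ∈ P, b ≠ v → G.Adj a b → b ∈ Z :=
    fun a ha b hb => hcl a ha b (by simp [hb])
  have hZP : ∀ p ∈ Z, p ∉ P := by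
    intro p hpZ hp
    have hcx : c ∈ Z → x = v := fun hc => by
      by_contra hxv
      exact hx (hcl c hc x (by simp) hxv hxc.symm)
    have hdy : d ∈ Z → y = v := fun hc => by
      by_contra hxv
      exact hy (hcl d hc y (by simp) hxv hyd.symm)
    by_cases hv : v ∈ P
    · rcases hP.end_mem_of_closed hp hpZ hclP with h' | h'
      · exact h.left_notMem_left (hcx h' ▸ hPX hv)
      · exact h.right_notMem_left (hdy h' ▸ hPX hv)
    · have := hP.subset_of_closed_of_notMem hp hpZ hv hclP
      exact h.ne ((hcx (this c hP.left_mem)).trans (hdy (this d hP.right_mem)).symm)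
  have hZY : ∀ p ∈ Z, p ∈ Y := by
    intro p hp
    have := (hZ p hp).1
    simp only [Finset.mem_insert, Finset.mem_union] at this
    rcases this with rfl | rfl | h | h
    exacts [absurd hp hx, absurd hp hy, h, absurd h (hZP p hp)]
  refine hne.ne_empty ?_
  by_cases hxv : v = y
  · refine h.swap.eq_empty_of_closed hG hZY (fun a ha b hb => hcl a ha b (by simp [hb]) ?_)
      (fun a ha h' => hx (hcl a ha x (by simp) (hxv ▸ h.ne) h'))
    rintro rfl
    exact h.right_notMem_right (hxv ▸ hb)
  · by_cases hvY : v ∈ Y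
    · have := hG.2 v (Finset.mem_univ _) Z (fun a ha => ⟨Finset.mem_univ _, (hZ a ha).2⟩) hne
        (fun a ha b _ hbv hab => by
          rcases h.mem b with rfl | rfl | hb | hb
          · exact hcl a ha _ (by simp) hbv hab
          · exact hcl a ha _ (by simp) hbv hab
          · exact absurd hab.symm (h.not_adj b hb a (hZY a ha))
          · exact hcl a ha _ (by simp [hb]) hbv hab) y (Finset.mem_univ _) (Ne.symm hxv)
      exact absurd this hy
    · refine h.eq_empty_of_closed hG hZY (fun a ha b hb => hcl a ha b (by simp [hb]) ?_)
        (fun a ha h' => hy (hcl a ha y (by simp) (Ne.symm hxv) h'))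
      rintro rfl
      exact hvY hb

theorem noCutVertex_aux₂ (h : IsSeparation G x y X Y) (hG : NoCutVertex G Finset.univ)
    {P : Finset V} {c d : V} (hPX : P ⊆ X) (hP : SpanPath G P c d) (hxc : G.Adj x c)
    (hyd : G.Adj y d) {v : V} {Z Z' : Set V}
    (hZ : ∀ a, a ∈ insert x (insert y (Y ∪ P)) ∧ a ≠ v ↔ a ∈ Z ∨ a ∈ Z')
    (hn : ∀ a ∈ Z, ∀ b ∈ Z', ¬ G.Adj a b) (hx : x ∈ Z) (hy : y ∈ Z') :
    False := by
  have hmem : ∀ a ∈ insert x (insert y (Y ∪ P)), a ≠ v → a ∈ Z ∨ a ∈ Z' :=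
    fun a ha hav => (hZ a).1 ⟨ha, hav⟩
  have hxv := ((hZ x).2 (.inl hx)).2
  have hyv := ((hZ y).2 (.inr hy)).2
  by_cases hvP : v ∈ P
  · have hvY : v ∉ Y := fun hv' => Finset.disjoint_left.1 h.disjoint (hPX hvP) hv'
    have hmemY : ∀ b ∈ Y, b ∈ Z ∨ b ∈ Z' := by
      intro b hb
      exact hmem b (by simp [hb]) (ne_of_mem_of_not_mem hb hvY)
    have h₁ : {a | a ∈ Y ∧ a ∈ Z} = ∅ := by
      refine h.eq_empty_of_closed hG (fun a ha => ha.1) (fun a ha b hb hab => ⟨hb, ?_⟩)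
        (fun a ha => hn a ha.2 y hy)
      exact (hmemY b hb).resolve_right fun hb' => hn a ha.2 b hb' hab
    have h₂ : {a | a ∈ Y ∧ a ∈ Z'} = ∅ := by
      refine h.swap.eq_empty_of_closed hG (fun a ha => ha.1) (fun a ha b hb hab => ⟨hb, ?_⟩)
        (fun a ha hax => hn x hx a ha.2 hax.symm)
      exact (hmemY b hb).resolve_left fun hb' => hn b hb' a ha.2 hab.symm
    obtain ⟨b, hb⟩ := h.nonempty_right
    rcases hmemY b hb with hb' | hb'
    · exact (Set.ext_iff.1 h₁ b).1 ⟨hb, hb'⟩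
    · exact (Set.ext_iff.1 h₂ b).1 ⟨hb, hb'⟩
  · have hPm : ∀ a ∈ P, a ∈ Z ∨ a ∈ Z' :=
      fun a ha => hmem a (by simp [ha]) (ne_of_mem_of_not_mem ha hvP)
    have hc : c ∈ Z := (hPm c hP.left_mem).resolve_right fun h' => hn x hx c h' hxc
    have hd := hP.subset_of_closed hc (fun a ha b hb hab =>
      (hPm b hb).resolve_right fun h' => hn a ha b h' hab) d hP.right_mem
    exact hn d hd y hy hyd.symm

/-- Replacing one side of a separation by a path keeps the graph 2-connected. -/
theorem noCutVertex (h : IsSeparation G x y X Y) (hG : NoCutVertex G Finset.univ)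
    {P : Finset V} {c d : V} (hPX : P ⊆ X) (hP : SpanPath G P c d) (hxc : G.Adj x c)
    (hyd : G.Adj y d) : NoCutVertex G (insert x (insert y (Y ∪ P))) := by
  refine ⟨?_, fun v _ Z hZ hne hcl a ha hav => ?_⟩
  · refine le_trans (le_of_eq ?_) (Finset.card_le_card (s := {x, y, c}) ?_)
    · refine (Finset.card_eq_three.2 ⟨x, y, c, h.ne, hxc.ne, ?_, rfl⟩).symm
      exact (ne_of_mem_of_not_mem (hPX hP.left_mem) h.right_notMem_left).symm
    · simp [Finset.insert_subset_iff, hP.left_mem]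
  by_contra haZ
  let Z' : Set V := {b | (b ∈ insert x (insert y (Y ∪ P)) ∧ b ≠ v) ∧ b ∉ Z}
  have hn : ∀ a ∈ Z, ∀ b ∈ Z', ¬ G.Adj a b := fun a ha b hb hab =>
    hb.2 (hcl a ha b hb.1.1 hb.1.2 hab)
  have hcov : ∀ b, b ∈ insert x (insert y (Y ∪ P)) ∧ b ≠ v ↔ b ∈ Z ∨ b ∈ Z' := by
    intro b
    constructor
    · intro hb
      by_cases hbZ : b ∈ Z
      exacts [.inl hbZ, .inr ⟨hb, hbZ⟩]
    · rintro (hb | hb)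
      exacts [hZ b hb, hb.1]
  have h₁ := h.noCutVertex_aux₁ hG hPX hP hxc hyd hZ hne hcl
  have h₂ := h.noCutVertex_aux₁ hG hPX hP hxc hyd (v := v) (Z := Z') (fun a ha => ha.1)
    ⟨a, ⟨ha, hav⟩, haZ⟩ (fun a ha b hb hbv hab =>
      ((hcov b).1 ⟨hb, hbv⟩).resolve_left fun hb' => hn b hb' a ha hab.symm)
  rcases h₁ with hx | hy <;> rcases h₂ with hx' | hy'
  · exact hx'.2 hx
  · exact h.noCutVertex_aux₂ hG hPX hP hxc hyd hcov hn hx hy'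
  · exact h.noCutVertex_aux₂ hG hPX hP hxc hyd (fun b => (hcov b).trans or_comm)
      (fun a ha b hb hab => hn b hb a ha hab.symm) hx' hy
  · exact hy'.2 hy

end IsSeparation

/-- A cycle through both vertices of a separating pair yields a spanning path of each side. -/
theorem SpanCycle.cut {x y : V} {Y P : Finset V} (hC : SpanCycle G (insert x (insert y (Y ∪ P))))
    (hxy : x ≠ y) (hxY : x ∉ Y) (hyY : y ∉ Y) (hxP : x ∉ P) (hyP : y ∉ P) (hd : Disjoint Y P)
    (hY : Y.Nonempty) (hP : P.Nonempty) (hn : ∀ a ∈ Y, ∀ b ∈ P, ¬ G.Adj a b) :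
    ∃ c d, SpanPath G Y c d ∧ G.Adj x c ∧ G.Adj y d := by
  obtain ⟨u, w, -, hu, hw, hp⟩ := hC.rotate (x := x) (by simp)
  rw [Finset.erase_insert (by simp [hxy, hxY, hxP])] at hp
  obtain ⟨S₁, S₂, hS, hdS, h₁, h₂⟩ := hp.split (x := y) (by simp)
  have hyS₁ := h₁.right_mem
  have hyS₂ : y ∉ S₂ := fun h => Finset.disjoint_left.1 hdS hyS₁ h
  have hmem : ∀ a, a ∈ S₁.erase y ∨ a ∈ S₂ ↔ a ∈ Y ∨ a ∈ P := by
    intro a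
    have := Finset.ext_iff.1 hS a
    by_cases ha : a = y
    · subst ha
      simp_all
    · simp only [Finset.mem_insert, ha, false_or, Finset.mem_union] at this
      simp [ha, this]
  have side : ∀ {R : Finset V} {s t : V}, SpanPath G R s t → (∀ a ∈ R, a ∈ Y ∨ a ∈ P) →
      R ⊆ Y ∨ R ⊆ P := by
    intro R s t h hR
    rcases hR s h.left_mem with hs | hs
    · refine .inl (h.subset_of_closed (D := (Y : Set V)) hs fun a ha b hb hab => ?_)
      exact (hR b hb).resolve_right fun hb' => hn a ha b hb' hab
    · refine .inr (h.subset_of_closed (D := (P : Set V)) hs fun a ha b hb hab => ?_)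
      exact (hR b hb).resolve_left fun hb' => hn b hb' a ha hab.symm
  have hdis : ∀ a ∈ Y, a ∉ P := fun a h h' => Finset.disjoint_left.1 hd h h'
  obtain ⟨cY, hcY⟩ := hY
  obtain ⟨cP, hcP⟩ := hP
  have hS₁ : S₁.erase y = ∅ ∨ ∃ u', G.Adj u' y ∧ SpanPath G (S₁.erase y) u u' := by
    rcases h₁.eq_or_concat with ⟨h, -⟩ | h
    · left
      simp [h]
    · exact .inr h
  have hS₂ : S₂ = ∅ ∨ ∃ y', G.Adj y y' ∧ SpanPath G S₂ y' w :=
    h₂.imp_left And.left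
  have hYm := (hmem cY).2 (.inl hcY)
  have hPm := (hmem cP).2 (.inr hcP)
  rcases hS₁ with h1 | ⟨u', hu', h1⟩
  · rcases hS₂ with h2 | ⟨y', -, h2⟩
    · simp [h1, h2] at hYm
    · simp only [h1, Finset.notMem_empty, false_or] at hYm hPm hmem
      rcases side h2 (fun a ha => (hmem a).1 ha) with h | h
      · exact absurd hcP (hdis cP (h hPm))
      · exact absurd (h hYm) (hdis cY hcY)
  · rcases hS₂ with h2 | ⟨y', hy', h2⟩
    · simp only [h2, Finset.notMem_empty, or_false] at hYm hPm hmem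
      rcases side h1 (fun a ha => (hmem a).1 ha) with h | h
      · exact absurd hcP (hdis cP (h hPm))
      · exact absurd (h hYm) (hdis cY hcY)
    · rcases side h1 (fun a ha => (hmem a).1 (.inl ha)) with h | h <;>
        rcases side h2 (fun a ha => (hmem a).1 (.inr ha)) with h' | h'
      · rcases hPm with hm | hm
        exacts [absurd hcP (hdis cP (h hm)), absurd hcP (hdis cP (h' hm))]
      · refine ⟨u, u', ?_, hu, hu'.symm⟩
        convert h1 using 1
        ext a
        exact ⟨fun ha => ((hmem a).2 (.inl ha)).resolve_right fun h'' => hdis a ha (h' h''),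
          fun ha => h ha⟩
      · refine ⟨w, y', ?_, hw, hy'⟩
        convert h2.symm using 1
        ext a
        exact ⟨fun ha => ((hmem a).2 (.inl ha)).resolve_left fun h'' => hdis a ha (h h''),
          fun ha => h' ha⟩
      · rcases hYm with hm | hm
        exacts [absurd (h hm) (hdis cY hcY), absurd (h' hm) (hdis cY hcY)]

namespace IsMinimalNonhamiltonian

variable [Fintype V]

/-- If one side of a separation is not a path, then the other side has a spanning path between the
separating vertices. -/
theorem spanPath_of_ne (hG : IsMinimalNonhamiltonian G) {x y : V} {X Y P : Finset V}
    (h : IsSeparation G x y X Y) {c d : V} (hPX : P ⊆ X) (hP : SpanPath G P c d)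
    (hxc : G.Adj x c) (hyd : G.Adj y d) (hne : P ≠ X) :
    ∃ c d, SpanPath G Y c d ∧ G.Adj x c ∧ G.Adj y d := by
  have hxP : x ∉ P := fun h' => h.left_notMem_left (hPX h')
  have hyP : y ∉ P := fun h' => h.right_notMem_left (hPX h')
  refine (hG.spanCycle_of_ne _ ?_ (h.noCutVertex hG.noCutVertex hPX hP hxc hyd)).cut h.ne
    h.left_notMem_right h.right_notMem_right hxP hyP (h.disjoint.symm.mono_right hPX)
    h.nonempty_right ⟨c, hP.left_mem⟩ fun a ha b hb hab => h.not_adj b (hPX hb) a ha hab.symm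
  intro hu
  refine hne (hPX.antisymm fun a ha => ?_)
  have := Finset.ext_iff.1 hu a
  simp only [Finset.mem_insert, Finset.mem_union, Finset.mem_univ, iff_true] at this
  rcases this with rfl | rfl | h' | h'
  exacts [absurd ha h.left_notMem_left, absurd ha h.right_notMem_left,
    absurd h' (Finset.disjoint_left.1 h.disjoint ha), h']

/-- Every vertex with at least three neighbours has a neighbour of degree two. -/
theorem exists_adj_degree_two (hG : IsMinimalNonhamiltonian G) {x r s t : V} (hrs : r ≠ s)
    (hrt : r ≠ t) (hst : s ≠ t) (hr : G.Adj x r) (hs : G.Adj x s) (ht : G.Adj x t) :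
    ∃ p y, y ≠ x ∧ ∀ w, G.Adj p w ↔ w = x ∨ w = y := by
  classical
  obtain ⟨y, X, Y, h⟩ : ∃ y X Y, IsSeparation G x y X Y := by
    by_contra hno
    refine hG.not_three_adj (q := x) ⟨?_, fun y hy X hX hne hcl c hc hcy => ?_⟩ hrs hrt hst hr hs ht
    · refine le_trans (le_of_eq ?_) (Finset.card_le_card (s := {r, s, t}) ?_)
      · exact (Finset.card_eq_three.2 ⟨r, s, t, hrs, hrt, hst, rfl⟩).symm
      · simp [Finset.insert_subset_iff, hr.ne', hs.ne', ht.ne']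
    · simp only [Finset.mem_erase, Finset.mem_univ, and_true] at hy hX hc hcl
      by_contra hcX
      refine hno ⟨y, Finset.univ.filter (· ∈ X),
        Finset.univ.filter fun a => a ≠ x ∧ a ≠ y ∧ a ∉ X, ?_⟩
      constructor
      · exact hy.symm
      · intro v
        simp only [Finset.mem_filter, Finset.mem_univ, true_and]
        tauto
      · rw [Finset.disjoint_left]
        simp only [Finset.mem_filter, Finset.mem_univ, true_and]
        tauto
      · simpa using fun hx => (hX x hx).1 rfl
      · simpa using fun hx => (hX y hx).2 rfl
      · simp
      · simp
      · obtain ⟨a, ha⟩ := hne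
        exact ⟨a, by simpa using ha⟩
      · exact ⟨c, by simp [hc, hcy, hcX]⟩
      · simp only [Finset.mem_filter, Finset.mem_univ, true_and]
        exact fun a ha b hb hab => hb.2.2 (hcl a ha b hb.1 hb.2.1 hab)
  have main : ∀ {X Y : Finset V}, IsSeparation G x y X Y →
      (∃ p y, y ≠ x ∧ ∀ w, G.Adj p w ↔ w = x ∨ w = y) ∨
      ∃ c d, SpanPath G X c d ∧ G.Adj x c ∧ G.Adj y d := by
    intro X Y h
    obtain ⟨f, n, h0, hn, hfY, hfx, hfy, hinj, hadj⟩ := h.exists_path hG.noCutVertex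
    have hP := SpanPath.of_fun (fun i hi => (hadj i (by omega) (i + 1) (by omega)).2 (.inl rfl)) hinj
    have hmemP : ∀ a, a ∈ (Finset.range (n + 1)).image f ↔ ∃ i ≤ n, f i = a := by
      simp
    by_cases hPY : (Finset.range (n + 1)).image f = Y
    · left
      have hmemY : ∀ a, a ∈ Y ↔ ∃ i ≤ n, f i = a := fun a => hPY ▸ hmemP a
      have hcase : ∀ w, G.Adj (f 0) w → w = x ∨ (n = 0 ∧ w = y) ∨ (1 ≤ n ∧ w = f 1) := by
        intro w hw
        rcases h.mem w with rfl | rfl | hwX | hwY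
        · exact .inl rfl
        · exact .inr (.inl ⟨(hfy 0 (by omega) hw.symm).symm, rfl⟩)
        · exact absurd hw.symm (h.not_adj w hwX _ (hfY 0 (by omega)))
        · obtain ⟨j, hj, rfl⟩ := (hmemY w).1 hwY
          rcases (hadj 0 (by omega) j hj).1 hw with h' | h'
          · obtain rfl : j = 1 := by omega
            exact .inr (.inr ⟨hj, rfl⟩)
          · omega
      rcases Nat.eq_zero_or_pos n with rfl | hpos
      · refine ⟨f 0, y, h.ne.symm, fun w => ⟨fun hw => ?_, ?_⟩⟩
        · rcases hcase w hw with h' | h' | h'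
          exacts [.inl h', .inr h'.2, by omega]
        · rintro (rfl | rfl)
          exacts [h0.symm, hn.symm]
      · refine ⟨f 0, f 1, ne_of_mem_of_not_mem (hfY 1 hpos) h.left_notMem_right,
          fun w => ⟨fun hw => ?_, ?_⟩⟩
        · rcases hcase w hw with h' | h' | h'
          exacts [.inl h', by omega, .inr h'.2]
        · rintro (rfl | rfl)
          exacts [h0.symm, (hadj 0 (by omega) 1 hpos).2 (.inl rfl)]
    · right
      refine hG.spanPath_of_ne h.symm (fun a ha => ?_) hP h0 hn hPY
      obtain ⟨i, hi, rfl⟩ := (hmemP a).1 ha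
      exact hfY i hi
  rcases main h with h₁ | ⟨c, d, hX, hc, hd⟩
  · exact h₁
  rcases main h.symm with h₁ | ⟨c', d', hY, hc', hd'⟩
  · exact h₁
  exfalso
  have h₁ := hX.concat h.right_notMem_left hd.symm
  have h₂ := h₁.append hY.symm (by simp [h.right_notMem_right, h.disjoint]) hd'
  refine hG.false_of_spanPath (h₂.concat (x := x) ?_ hc'.symm) ?_ hc
  · simp [h.ne, h.left_notMem_left, h.left_notMem_right]
  · intro v
    have := h.mem v
    simp only [Finset.mem_insert, Finset.mem_union]
    tauto

end IsMinimalNonhamiltonian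

end Separation

section Core

variable {V : Type*} [DecidableEq V] [Fintype V] {G : SimpleGraph V}

theorem NoCutVertex.exists_adj_ne (hG : NoCutVertex G Finset.univ) {x v : V} (hxv : x ≠ v) :
    ∃ t, t ≠ v ∧ G.Adj x t := by
  by_contra! h
  have hcard : ({x, v} : Finset V).card < (Finset.univ : Finset V).card :=
    Finset.card_le_two.trans_lt hG.1
  obtain ⟨w, -, hw⟩ := Finset.exists_mem_notMem_of_card_lt_card hcard
  simp only [Finset.mem_insert, Finset.mem_singleton, not_or] at hw
  exact hw.1 (hG.2 v (Finset.mem_univ _) {x} (by simp [hxv]) ⟨x, rfl⟩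
    (by rintro _ rfl b - hb hab; exact absurd hab (h b hb)) w (Finset.mem_univ _) hw.2)

theorem NoCutVertex.exists_two_adj (hG : NoCutVertex G Finset.univ) (x : V) :
    ∃ s t, s ≠ t ∧ G.Adj x s ∧ G.Adj x t := by
  obtain ⟨v, -, hv⟩ := Finset.exists_mem_ne (s := Finset.univ) (by have := hG.1; omega) x
  obtain ⟨s, -, hs⟩ := hG.exists_adj_ne (x := x) hv.symm
  obtain ⟨t, hts, ht⟩ := hG.exists_adj_ne (x := x) hs.ne
  exact ⟨s, t, hts.symm, hs, ht⟩

namespace IsMinimalNonhamiltonian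

/-- An edge whose ends have a common neighbour of degree two lies in no other triangle. -/
theorem not_common_adj (hG : IsMinimalNonhamiltonian G) {p x y z : V}
    (hp : ∀ w, G.Adj p w ↔ w = x ∨ w = y) (hxy : G.Adj x y) (hzp : z ≠ p) (hzx : G.Adj z x)
    (hzy : G.Adj z y) : False := by
  have hpx : G.Adj p x := (hp x).2 (.inl rfl)
  have hpy : G.Adj p y := (hp y).2 (.inr rfl)
  have hN : NoCutVertex G (Finset.univ.erase p) := by
    refine ⟨?_, fun v hv Z hZ hne hcl c hc hcv => ?_⟩
    · refine le_trans (le_of_eq ?_) (Finset.card_le_card (s := {x, y, z}) ?_)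
      · exact (Finset.card_eq_three.2 ⟨x, y, z, hxy.ne, hzx.ne', hzy.ne', rfl⟩).symm
      · simp [Finset.insert_subset_iff, hpx.ne', hpy.ne', hzp]
    · simp only [Finset.mem_erase, Finset.mem_univ, and_true] at hv hZ hc hcl
      have := hG.noCutVertex.2 v (Finset.mem_univ _) {a | a ∈ Z ∨ (a = p ∧ (x ∈ Z ∨ y ∈ Z))}
        (by
          rintro a (ha | ⟨rfl, -⟩)
          exacts [⟨Finset.mem_univ _, (hZ a ha).2⟩, ⟨Finset.mem_univ _, hv.symm⟩])
        (hne.mono fun a ha => .inl ha) (by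
          rintro a (ha | ⟨rfl, ha⟩) b - hbv hab
          · by_cases hb : b = p
            · subst hb
              rcases (hp a).1 hab.symm with rfl | rfl
              exacts [.inr ⟨rfl, .inl ha⟩, .inr ⟨rfl, .inr ha⟩]
            · exact .inl (hcl a ha b hb hbv hab)
          · left
            rcases (hp b).1 hab with rfl | rfl <;> rcases ha with ha | ha
            · exact ha
            · exact hcl _ ha _ hpx.ne' hbv hxy.symm
            · exact hcl _ ha _ hpy.ne' hbv hxy
            · exact ha) c (Finset.mem_univ _) hcv
      exact this.resolve_right fun h => hc h.1
  have hC := hG.spanCycle_of_ne _ (by simp [Finset.ext_iff]) hN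
  obtain ⟨a₁, a₂, ha, hxa₁, hxa₂, hP⟩ := hC.rotate (x := x) (by simp [hpx.ne'])
  have hmem : ∀ v, v ∈ (Finset.univ.erase p).erase x ↔ v ≠ x ∧ v ≠ p := by simp
  have hend : ∀ {a}, SpanPath G ((Finset.univ.erase p).erase x) a y → G.Adj x a → False := by
    intro a h hxa
    refine hG.false_of_spanPath ((h.concat (x := p) (by simp) hpy.symm).concat (x := x)
      (by simp [hpx.ne']) hpx) (fun v => ?_) hxa
    have := hmem v
    simp only [Finset.mem_insert]
    tauto
  obtain ⟨S₁, S₂, hS, hd, h₁, h₂⟩ := hP.split (x := y) (by simp [hxy.ne', hpy.ne'])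
  have hyS₂ : y ∉ S₂ := fun h => Finset.disjoint_left.1 hd h₁.right_mem h
  rcases h₁.eq_or_concat with ⟨-, rfl⟩ | ⟨b₁, hb₁, h₁'⟩
  · exact hend hP.symm hxa₂
  rcases h₂ with ⟨-, rfl⟩ | ⟨b₂, hb₂, h₂⟩
  · exact hend hP hxa₁
  have hcov : ∀ v, v ∈ S₁.erase y ∨ v ∈ S₂ ↔ v ≠ x ∧ v ≠ y ∧ v ≠ p := by
    intro v
    have h1 := hmem v
    rw [hS, Finset.mem_union] at h1
    by_cases hv : v = y
    · subst hv
      simp [hyS₂]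
    · simp [hv, h1]
  have hd' : Disjoint (S₁.erase y) S₂ := hd.mono_left (Finset.erase_subset _ _)
  have hne : ∀ v, v ∈ S₁.erase y ∨ v ∈ S₂ → ¬ G.Adj p v := by
    intro v hv hpv
    have := (hcov v).1 hv
    rcases (hp v).1 hpv with h | h
    exacts [this.1 h, this.2.1 h]
  have hb : b₁ ≠ b₂ := fun h => Finset.disjoint_left.1 hd' h₁'.right_mem (h ▸ h₂.left_mem)
  have ma₁ := (hcov a₁).1 (.inl h₁'.left_mem)
  have mb₁ := (hcov b₁).1 (.inl h₁'.right_mem)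
  have ma₂ := (hcov a₂).1 (.inr h₂.right_mem)
  have mb₂ := (hcov b₂).1 (.inr h₂.left_mem)
  have na₁ := hne a₁ (.inl h₁'.left_mem)
  have nb₁ := hne b₁ (.inl h₁'.right_mem)
  have na₂ := hne a₂ (.inr h₂.right_mem)
  have nb₂ := hne b₂ (.inr h₂.left_mem)
  have haa : G.Adj a₁ a₂ :=
    hG.clawFree.adj_of_not_adj ma₁.2.2.symm ma₂.2.2.symm ha hpx.symm hxa₁ hxa₂ na₁ na₂
  have hbb : G.Adj b₁ b₂ :=
    hG.clawFree.adj_of_not_adj mb₁.2.2.symm mb₂.2.2.symm hb hpy.symm hb₁.symm hb₂ nb₁ nb₂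
  have key : ∀ {R₁ R₂ : Finset V} {a₁ b₁ a₂ b₂ : V}, SpanPath G R₁ a₁ b₁ → SpanPath G R₂ b₂ a₂ →
      Disjoint R₁ R₂ → (∀ v, v ∈ R₁ ∨ v ∈ R₂ ↔ v ≠ x ∧ v ≠ y ∧ v ≠ p) → G.Adj x a₂ →
      G.Adj y b₂ → G.Adj a₁ a₂ → G.Adj b₁ b₂ → ¬ G.Adj b₁ x ∧ ¬ G.Adj a₁ y := by
    intro R₁ R₂ a₁ b₁ a₂ b₂ h₁ h₂ hd hcov hxa₂ hyb₂ haa hbb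
    have hx := hcov x
    have hy := hcov y
    have hpp := hcov p
    simp only [ne_eq, not_true_eq_false, false_and, and_false, iff_false, not_or] at hx hy hpp
    constructor
    · intro hbx
      refine hG.false_of_spanPath ((((h₁.concat hx.1 hbx).concat (x := p) ?_ hpx.symm).concat
        (x := y) ?_ hpy).append h₂ ?_ hyb₂) ?_ haa.symm
      · simp [hpp, hpx.ne]
      · simp [hy, hpy.ne', hxy.ne']
      · simp [hy, hpp, hx, hd]
      · intro v
        have := hcov v
        simp only [Finset.mem_union, Finset.mem_insert]
        tauto
    · intro hay
      refine hG.false_of_spanPath ((((h₁.append h₂ hd hbb).concat (x := x) ?_ hxa₂.symm).concat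
        (x := p) ?_ hpx.symm).concat (x := y) ?_ hpy) ?_ hay.symm
      · simp [hx]
      · simp [hpp, hpx.ne]
      · simp [hy, hpy.ne', hxy.ne']
      · intro v
        have := hcov v
        simp only [Finset.mem_union, Finset.mem_insert]
        tauto
  obtain ⟨nbx₁, nay₁⟩ := key h₁' h₂ hd' hcov hxa₂ hb₂ haa hbb
  obtain ⟨nbx₂, nay₂⟩ := key h₂.symm h₁'.symm hd'.symm (fun v => or_comm.trans (hcov v)) hxa₁
    hb₁.symm haa.symm hbb.symm
  have npz : ¬ G.Adj p z := fun h => by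
    rcases (hp z).1 h with rfl | rfl
    exacts [G.irrefl hzx, G.irrefl hzy]
  have hza : ∀ {a}, G.Adj x a → ¬ G.Adj a y → ¬ G.Adj p a → p ≠ a → G.Adj z a := by
    intro a hxa hay hpa hne
    refine hG.clawFree.adj_of_not_adj hzp.symm hne ?_ hpx.symm hzx.symm hxa npz hpa
    rintro rfl
    exact hay hzy
  have hzb : ∀ {b}, G.Adj y b → ¬ G.Adj b x → ¬ G.Adj p b → p ≠ b → G.Adj z b := by
    intro b hyb hbx hpb hne
    refine hG.clawFree.adj_of_not_adj hzp.symm hne ?_ hpy.symm hzy.symm hyb npz hpb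
    rintro rfl
    exact hbx hzx
  have hza₁ := hza hxa₁ nay₁ na₁ ma₁.2.2.symm
  have hza₂ := hza hxa₂ nay₂ na₂ ma₂.2.2.symm
  have hzb₁ := hzb hb₁.symm nbx₁ nb₁ mb₁.2.2.symm
  have hzb₂ := hzb hb₂ nbx₂ nb₂ mb₂.2.2.symm
  obtain ⟨q, z', hz', hq⟩ := hG.exists_adj_degree_two hxy.ne ma₁.1.symm ma₁.2.1.symm hzx hzy hza₁
  have hqz := (hq z).2 (.inl rfl)
  have hdeg : ∀ {a b c : V}, a ≠ b → a ≠ z → b ≠ z → G.Adj c a → G.Adj c b → q ≠ c := by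
    rintro a b c hab haz hbz hca hcb rfl
    rcases (hq a).1 hca with h | h
    · exact haz h
    rcases (hq b).1 hcb with h' | h'
    · exact hbz h'
    exact hab (h.trans h'.symm)
  have hqx : q ≠ x := hdeg hpy.ne hzp.symm hzy.ne' hpx.symm hxy
  have hqy : q ≠ y := hdeg hpx.ne hzp.symm hzx.ne' hpy.symm hxy.symm
  have hqa : ∀ {a}, q ≠ a → G.Adj z a → ¬ G.Adj a y → a ≠ y → z' = a ∨ z' = y := by
    intro a hqa hza hay hay'
    by_contra! h
    refine hay (hG.clawFree.adj_of_not_adj hqa hqy hay' hqz.symm hza hzy ?_ ?_)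
    · rw [hq]
      rintro (h' | h')
      exacts [G.irrefl (h' ▸ hza), h.1 h'.symm]
    · rw [hq]
      rintro (h' | h')
      exacts [G.irrefl (h' ▸ hzy), h.2 h'.symm]
  have hqb : ∀ {b}, q ≠ b → G.Adj z b → ¬ G.Adj b x → b ≠ x → z' = b ∨ z' = x := by
    intro a hqa hza hay hay'
    by_contra! h
    refine hay (hG.clawFree.adj_of_not_adj hqa hqx hay' hqz.symm hza hzx ?_ ?_)
    · rw [hq]
      rintro (h' | h')
      exacts [G.irrefl (h' ▸ hza), h.1 h'.symm]
    · rw [hq]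
      rintro (h' | h')
      exacts [G.irrefl (h' ▸ hzx), h.2 h'.symm]
  have h1 := hqa (hdeg ma₂.1 hza₂.ne' hzx.ne' haa hxa₁.symm) hza₁ nay₁ ma₁.2.1
  have h2 := hqa (hdeg ma₁.1 hza₁.ne' hzx.ne' haa.symm hxa₂.symm) hza₂ nay₂ ma₂.2.1
  have h3 := hqb (hdeg mb₂.2.1 hzb₂.ne' hzy.ne' hbb hb₁) hzb₁ nbx₁ mb₁.1
  have h4 := hqb (hdeg mb₁.2.1 hzb₁.ne' hzy.ne' hbb.symm hb₂.symm) hzb₂ nbx₂ mb₂.1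
  have h5 : z' = y := by
    rcases h1 with h | h
    · rcases h2 with h' | h'
      exacts [absurd (h.symm.trans h') ha, h']
    · exact h
  have h6 : z' = x := by
    rcases h3 with h | h
    · rcases h4 with h' | h'
      exacts [absurd (h.symm.trans h') hb, h']
    · exact h
  exact hxy.ne (h6.symm.trans h5)

end IsMinimalNonhamiltonian

/-- A vertex which is not a simplicial vertex of degree two. -/
def IsCore (G : SimpleGraph V) (x : V) : Prop :=
  ¬ ∃ s t, G.Adj s t ∧ ∀ w, G.Adj x w ↔ w = s ∨ w = t

/-- The edge from `x` to `l` is the only edge of the core at `x` outside of a clique. -/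
structure IsLink (G : SimpleGraph V) (x l : V) : Prop where
  core : IsCore G l
  adj : G.Adj x l
  clique : ∀ a b, IsCore G a → IsCore G b → G.Adj x a → G.Adj x b → a ≠ l → b ≠ l → a ≠ b →
    G.Adj a b
  not_adj : ∀ a, IsCore G a → G.Adj x a → a ≠ l → ¬ G.Adj a l
  apex : (∃ p, ∀ w, G.Adj p w ↔ w = x ∨ w = l) ∨ (∃ y, ∀ w, G.Adj l w → w = x ∨ w = y) ∨
    ∃ y, ∀ w, G.Adj x w → w = l ∨ w = y

theorem IsMinimalNonhamiltonian.exists_isLink (hG : IsMinimalNonhamiltonian G) {x : V}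
    (hx : IsCore G x) : ∃ l, IsLink G x l := by
  obtain ⟨s, t, hst, hs, ht⟩ := hG.noCutVertex.exists_two_adj x
  by_cases h3 : ∃ r, r ≠ s ∧ r ≠ t ∧ G.Adj x r
  · obtain ⟨r, hrs, hrt, hr⟩ := h3
    obtain ⟨p, y, hyx, hp⟩ := hG.exists_adj_degree_two hrs hrt hst hr hs ht
    have hpx := (hp x).2 (.inl rfl)
    have hpy := (hp y).2 (.inr rfl)
    by_cases hxy : G.Adj x y
    · have hpc : ∀ a, IsCore G a → a ≠ p := by
        rintro a ha rfl
        exact ha ⟨x, y, hxy, hp⟩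
      refine ⟨y, ⟨?_, hxy, fun a b hca hcb ha hb hay hby hab => ?_, fun a hca ha hay haya => ?_,
        .inl ⟨p, hp⟩⟩⟩
      · rintro ⟨s', t', -, hy⟩
        have hy' : ∀ w, G.Adj y w → w = p ∨ w = x := by
          intro w hw
          have h1 := (hy w).1 hw
          have h2 := (hy p).1 hpy.symm
          have h3 := (hy x).1 hxy.symm
          have h4 := hpx.ne
          grind
        have hcl : ∀ c, c ≠ x → c = p ∨ c = y := by
          intro c hc
          exact hG.noCutVertex.2 x (Finset.mem_univ _) {a | a = p ∨ a = y}
            (by rintro a (rfl | rfl) <;> simp [hyx, hpx.ne]) ⟨p, .inl rfl⟩ (by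
              rintro a (rfl | rfl) b - hbx hab
              · exact .inr (((hp b).1 hab).resolve_left hbx)
              · exact .inl ((hy' b hab).resolve_right hbx)) c (Finset.mem_univ _) hc
        have h1 := hcl r hr.ne'
        have h2 := hcl s hs.ne'
        have h3 := hcl t ht.ne'
        grind
      · refine hG.clawFree.adj_of_not_adj (hpc a hca).symm (hpc b hcb).symm hab hpx.symm ha hb ?_ ?_
        · rw [hp]
          simp [ha.ne', hay]
        · rw [hp]
          simp [hb.ne', hby]
      · exact hG.not_common_adj hp hxy (hpc a hca) ha.symm haya
    · have hna : ∀ a, G.Adj x a → ¬ G.Adj p a := by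
        intro a ha hpa
        rcases (hp a).1 hpa with rfl | rfl
        exacts [G.irrefl ha, hxy ha]
      refine ⟨p, ⟨?_, hpx.symm, fun a b hca hcb ha hb hap hbp hab => ?_,
        fun a hca ha hap h => hna a ha h.symm, .inr (.inl ⟨y, fun w hw => (hp w).1 hw⟩)⟩⟩
      · rintro ⟨s', t', hadj, h'⟩
        have h1 := (hp s').1 ((h' s').2 (.inl rfl))
        have h2 := (hp t').1 ((h' t').2 (.inr rfl))
        rcases h1 with rfl | rfl <;> rcases h2 with rfl | rfl
        exacts [G.irrefl hadj, hxy hadj, hxy hadj.symm, G.irrefl hadj]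
      · exact hG.clawFree.adj_of_not_adj hap.symm hbp.symm hab hpx.symm ha hb (hna a ha) (hna b hb)
  · have hN : ∀ w, G.Adj x w → w = s ∨ w = t := by
      intro w hw
      by_contra! h
      exact h3 ⟨w, h.1, h.2, hw⟩
    have hnst : ¬ G.Adj s t := by
      intro h
      refine hx ⟨s, t, h, fun w => ⟨hN w, ?_⟩⟩
      rintro (rfl | rfl)
      exacts [hs, ht]
    have hK : ∀ a, G.Adj x a → a ≠ s → a = t := fun a ha has => (hN a ha).resolve_left has
    refine ⟨s, ⟨?_, hs, fun a b _ _ ha hb has hbs hab => ?_, fun a _ ha has h => ?_,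
      .inr (.inr ⟨t, hN⟩)⟩⟩
    · rintro ⟨s', t', hadj, h'⟩
      rcases (h' x).1 hs.symm with rfl | rfl
      · rcases hN t' hadj with rfl | rfl
        exacts [G.irrefl ((h' _).2 (.inr rfl)), hnst ((h' _).2 (.inr rfl))]
      · rcases hN s' hadj.symm with rfl | rfl
        exacts [G.irrefl ((h' _).2 (.inl rfl)), hnst ((h' _).2 (.inl rfl))]
    · exact absurd ((hK a ha has).trans (hK b hb hbs).symm) hab
    · obtain rfl := hK a ha has
      exact hnst h.symm

end Core

section Ear

variable {V : Type*} [DecidableEq V] [Fintype V] {G : SimpleGraph V}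

theorem NoCutVertex.exists_spanCycle (hG : NoCutVertex G Finset.univ) : ∃ S, SpanCycle G S := by
  classical
  obtain ⟨v, -⟩ := Finset.card_pos.1 (show 0 < (Finset.univ : Finset V).card by
    have := hG.1
    omega)
  obtain ⟨S, hS, hmax⟩ := Finset.exists_max_image
    (Finset.univ.filter fun S => ∃ a b, SpanPath G S a b) Finset.card
    ⟨{v}, by simpa using ⟨v, v, .single v⟩⟩
  simp only [Finset.mem_filter, Finset.mem_univ, true_and] at hS hmax
  obtain ⟨a, b, hS⟩ := hS
  have hN : ∀ s, G.Adj a s → s ∈ S := by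
    intro s hs
    by_contra hsS
    have := hmax _ ⟨s, b, .cons hsS hs.symm hS⟩
    rw [Finset.card_insert_of_notMem hsS] at this
    omega
  obtain ⟨s, t, hst, hs, ht⟩ := hG.exists_two_adj a
  rcases hS.eq_or_cons with ⟨h, -⟩ | ⟨a', ha', hS'⟩
  · have := hN s hs
    rw [h, Finset.mem_singleton] at this
    exact absurd this hs.ne'
  have key : ∀ s, G.Adj a s → s ≠ a' → ∃ S, SpanCycle G S := by
    intro s hs hsa
    obtain ⟨S₁, S₂, h, -, h₁, -⟩ := hS'.split (x := s) (by simp [hs.ne', hN s hs])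
    refine ⟨_, .of_path (x := a) ?_ hsa.symm ha' hs h₁⟩
    intro haS
    have : a ∈ S.erase a := h ▸ Finset.mem_union_left _ haS
    simp at this
  by_cases hsa : s = a'
  · exact key t ht (hsa ▸ hst.symm)
  · exact key s hs hsa

theorem IsCore.of_adj {x r s t : V} (hrs : r ≠ s) (hrt : r ≠ t) (hst : s ≠ t) (hr : G.Adj x r)
    (hs : G.Adj x s) (ht : G.Adj x t) : IsCore G x := by
  rintro ⟨y, z, -, h⟩
  have h1 := (h r).1 hr
  have h2 := (h s).1 hs
  have h3 := (h t).1 ht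
  grind

/-- A path meeting a set `E` of core vertices that is closed under adjacency between core vertices
has all its core vertices in `E`. -/
theorem SpanPath.core_subset_of_closed {W : Finset V} {a b : V} (hW : SpanPath G W a b) {E : Set V}
    (ha : a ∈ E) (hE : ∀ x ∈ E, ∀ y ∈ W, IsCore G y → G.Adj x y → y ∈ E) :
    ∀ x ∈ W, IsCore G x → x ∈ E := by
  intro x hx hcx
  refine (hW.subset_of_closed
    (D := {p | p ∈ E ∨ (¬ IsCore G p ∧ ∃ e ∈ E, G.Adj p e)}) (.inl ha) ?_ x hx).resolve_right
    fun h => h.1 hcx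
  rintro p (hp | ⟨hp, e, he, hpe⟩) y hy hpy
  · by_cases hcy : IsCore G y
    · exact .inl (hE p hp y hy hcy hpy)
    · exact .inr ⟨hcy, p, hp, hpy.symm⟩
  · by_cases hye : y = e
    · exact .inl (hye ▸ he)
    rw [IsCore, not_not] at hp
    obtain ⟨s, t, hst, hN⟩ := hp
    have hey : G.Adj e y := by
      rcases (hN e).1 hpe with rfl | rfl <;> rcases (hN y).1 hpy with rfl | rfl
      exacts [absurd rfl hye, hst, hst.symm, absurd rfl hye]
    by_cases hcy : IsCore G y
    · exact .inl (hE e he y hy hcy hey)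
    · exact .inr ⟨hcy, e, he, hey.symm⟩

/-- A shortest path outside of `S` which starts at a neighbour of a vertex `u` of `S` and ends at a
neighbour of another vertex of `S`. -/
theorem NoCutVertex.exists_ear (hG : NoCutVertex G Finset.univ) {S : Finset V} (hc : 3 ≤ S.card)
    (hne : S ≠ Finset.univ) :
    ∃ u v, u ∈ S ∧ v ∈ S ∧ v ≠ u ∧ ∃ (f : ℕ → V) (n : ℕ), G.Adj u (f 0) ∧ G.Adj (f n) v ∧
      (∀ i ≤ n, f i ∉ S) ∧ (∀ i ≤ n, G.Adj u (f i) → i = 0) ∧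
      (∀ i ≤ n, ∀ j ≤ n, f i = f j → i = j) ∧
      (∀ i ≤ n, ∀ j ≤ n, G.Adj (f i) (f j) ↔ i + 1 = j ∨ j + 1 = i) := by
  obtain ⟨w₀, hw₀⟩ : ∃ w, w ∉ S := by
    by_contra! h
    exact hne (Finset.eq_univ_of_forall h)
  obtain ⟨x, hx, y, hy, hxy⟩ := Finset.one_lt_card.1 (show 1 < S.card by omega)
  obtain ⟨u, hu, w, hw, huw⟩ : ∃ u ∈ S, ∃ w, w ∉ S ∧ G.Adj u w := by
    by_contra! h
    have := hG.2 x (Finset.mem_univ _) {a | a ∈ S ∧ a ≠ x} (fun a ha => ⟨Finset.mem_univ _, ha.2⟩)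
      ⟨y, hy, hxy.symm⟩ (fun a ha b _ hbx hab => ⟨by_contra fun hb => h a ha.1 b hb hab, hbx⟩)
      w₀ (Finset.mem_univ _) (ne_of_mem_of_not_mem hx hw₀).symm
    exact hw₀ this.1
  obtain ⟨f, n, h0, ⟨v, hv, hvu, hfv⟩, hS, hA, -, hinj, hadj⟩ := exists_shortest_path G {a | a ∉ S}
    {a | G.Adj u a} {a | ∃ v ∈ S, v ≠ u ∧ G.Adj a v} fun D hDS hD hcl => by
      by_contra hn
      obtain ⟨z, hz, hzu⟩ := Finset.exists_mem_ne (show 1 < S.card by omega) u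
      have := hG.2 u (Finset.mem_univ _) D
        (fun a ha => ⟨Finset.mem_univ _, (ne_of_mem_of_not_mem hu (hDS ha)).symm⟩)
        ⟨w, hD ⟨huw, hw⟩⟩ (fun a ha b _ hbu hab => by
          by_cases hb : b ∈ S
          · exact absurd ⟨a, ha, b, hb, hbu, hab⟩ hn
          · exact hcl a ha b hb hab) z (Finset.mem_univ _) hzu
      exact hDS this hz
  exact ⟨u, v, hu, hv, hvu, f, n, h0, hfv, hS, hA, hinj, hadj⟩

/-- There is a core vertex `u` with link `l`, such that the core remains connected enough between
`l` and the other core neighbours of `u` when `u` and one of these are deleted. -/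
theorem IsMinimalNonhamiltonian.exists_detour (hG : IsMinimalNonhamiltonian G) :
    ∃ u l u₀, IsLink G u l ∧ IsCore G u ∧ (IsCore G u₀ ∧ G.Adj u u₀ ∧ u₀ ≠ l) ∧
      ∀ u₁, IsCore G u₁ → G.Adj u u₁ → u₁ ≠ l → ∀ E : Set V,
        (∀ a, IsCore G a → G.Adj u a → a ≠ l → a ≠ u₁ → a ∈ E) →
        (∀ a ∈ E, ∀ b, IsCore G b → b ≠ u → b ≠ u₁ → G.Adj a b → b ∈ E) → l ∈ E := by
  classical
  obtain ⟨S₀, hS₀⟩ := hG.noCutVertex.exists_spanCycle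
  obtain ⟨S, hS, hmax⟩ := Finset.exists_max_image (Finset.univ.filter fun S => SpanCycle G S)
    Finset.card ⟨S₀, by simpa using hS₀⟩
  simp only [Finset.mem_filter, Finset.mem_univ, true_and] at hS hmax
  obtain ⟨u, v, hu, hv, hvu, f, n, h0, hfv, hfS, hfu, hinj, hadj⟩ :=
    hG.noCutVertex.exists_ear hS.1 (by rintro rfl; exact hG.not_spanCycle hS)
  set Q := (Finset.range (n + 1)).image f with hQdef
  have hQ : SpanPath G Q (f 0) (f n) :=
    .of_fun (fun i hi => (hadj i (by omega) (i + 1) (by omega)).2 (.inl rfl)) hinj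
  have hmemQ : ∀ a, a ∈ Q ↔ ∃ i ≤ n, f i = a := by simp [hQdef]
  have hQS : ∀ a ∈ Q, a ∉ S := by
    intro a ha
    obtain ⟨i, hi, rfl⟩ := (hmemQ a).1 ha
    exact hfS i hi
  clear_value Q
  have long : ∀ {T : Finset V} {p q z : V}, SpanPath G T p q → G.Adj q p → S ⊆ T → z ∈ T →
      z ∉ S → False := by
    intro T p q z hT hqp hST hzT hzS
    have h := Finset.card_lt_card ((Finset.ssubset_iff_of_subset hST).2 ⟨z, hzT, hzS⟩)
    have := hmax T ⟨hS.1.trans h.le, p, q, hT, hqp⟩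
    omega
  have hf0 := hfS 0 (by omega)
  have hfn := hfS n le_rfl
  obtain ⟨a, c, hac, hua, huc, hP⟩ := hS.rotate hu
  have ends : ∀ {a c : V}, SpanPath G (S.erase u) a c → G.Adj u a → G.Adj u c →
      ¬ G.Adj (f 0) a ∧ v ≠ a := by
    intro a c hP hua huc
    constructor
    · intro h
      refine long ((SpanPath.cons (by simp [hf0]) h hP).concat (x := u) ?_ huc.symm) h0 ?_
        (z := f 0) (by simp) hf0
      · simp [h0.ne]
      · intro z hz
        by_cases hzu : z = u <;> simp [hzu, hz]
    · rintro rfl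
      refine long ((hQ.append hP ?_ hfv).concat (x := u) ?_ huc.symm) h0 ?_ (z := f 0)
        (by simp [hQ.left_mem]) hf0
      · rw [Finset.disjoint_left]
        exact fun x hx hx' => hQS x hx (Finset.mem_of_mem_erase hx')
      · simpa using fun h => hQS u h hu
      · intro z hz
        by_cases hzu : z = u <;> simp [hzu, hz]
  obtain ⟨hf0a, hva⟩ := ends hP hua huc
  obtain ⟨hf0c, hvc⟩ := ends hP.symm huc hua
  have hne : ∀ {x}, x ∈ S → f 0 ≠ x := fun hx h => hf0 (h ▸ hx)
  have hne' : ∀ {x}, x ∈ S → f n ≠ x := fun hx h => hfn (h ▸ hx)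
  have hmemP : ∀ x, x ∈ S.erase u → x ∈ S := fun x hx => Finset.mem_of_mem_erase hx
  have haS := hmemP a hP.left_mem
  have hcS := hmemP c hP.right_mem
  have haac : G.Adj a c := hG.clawFree.adj_of_not_adj (hne haS) (hne hcS) hac h0 hua huc hf0a hf0c
  obtain ⟨T₁, S₂, hT, hd, hT₁, hS₂⟩ := hP.split (x := v) (by simp [hv, hvu])
  rcases hT₁.eq_or_concat with ⟨-, rfl⟩ | ⟨b, hbv, h₁⟩
  · exact absurd rfl hva
  rcases hS₂ with ⟨-, rfl⟩ | ⟨d, hvd, h₂⟩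
  · exact absurd rfl hvc
  have hvS₂ : v ∉ S₂ := fun h => Finset.disjoint_left.1 hd hT₁.right_mem h
  obtain ⟨S₁, hS₁⟩ : ∃ S₁, S₁ = T₁.erase v := ⟨_, rfl⟩
  rw [← hS₁] at h₁
  have hd' : Disjoint S₁ S₂ := by
    rw [hS₁]
    exact hd.mono_left (Finset.erase_subset _ _)
  have hcov : ∀ x, x ∈ S₁ ∨ x ∈ S₂ ↔ x ∈ S ∧ x ≠ u ∧ x ≠ v := by
    intro x
    have h1 := Finset.ext_iff.1 hT x
    rw [Finset.mem_union, Finset.mem_erase] at h1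
    by_cases hx : x = v
    · subst hx
      simp [hvS₂, hS₁]
    · simp [hx, hS₁, ← h1, and_comm]
  clear hT hP hT₁ hS₁ hd ends
  have hu₁₂ := hcov u
  have hv₁₂ := hcov v
  simp only [ne_eq, not_true_eq_false, false_and, and_false, iff_false, not_or] at hu₁₂ hv₁₂
  have hbS := ((hcov b).1 (.inl h₁.right_mem)).1
  have hdS := ((hcov d).1 (.inr h₂.left_mem)).1
  have hfn₁₂ : f n ∉ S₁ ∧ f n ∉ S₂ := by
    have := hcov (f n)
    tauto
  have hbd : b ≠ d := fun h => Finset.disjoint_left.1 hd' h₁.right_mem (h ▸ h₂.left_mem)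
  have hfnb : ¬ G.Adj (f n) b := by
    intro h
    refine long ((((h₁.concat hfn₁₂.1 h.symm).concat (x := v) ?_ hfv).append h₂ ?_ hvd).concat
      (x := u) ?_ huc.symm) hua ?_ (z := f n) (by simp) hfn
    · simp [hv₁₂, hne' hv |>.symm]
    · simp [hv₁₂, hd', hfn₁₂]
    · simp [hu₁₂, hvu.symm, hne' hu |>.symm]
    · intro x hx
      have := hcov x
      simp only [Finset.mem_insert, Finset.mem_union]
      tauto
  have hfnd : ¬ G.Adj (f n) d := by
    intro h
    refine long ((((h₁.concat hv₁₂.1 hbv).concat (x := f n) ?_ hfv.symm).append h₂ ?_ h).concat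
      (x := u) ?_ huc.symm) hua ?_ (z := f n) (by simp) hfn
    · simp [hfn₁₂, hne' hv]
    · simp [hv₁₂, hd', hfn₁₂]
    · simp [hu₁₂, hvu.symm, hne' hu |>.symm]
    · intro x hx
      have := hcov x
      simp only [Finset.mem_insert, Finset.mem_union]
      tauto
  have hbbd : G.Adj b d :=
    hG.clawFree.adj_of_not_adj (hne' hbS) (hne' hdS) hbd hfv.symm hbv.symm hvd hfnb hfnd
  have hQ' : ∀ x ∈ Q, x ∉ S₁ ∧ x ∉ S₂ ∧ x ≠ u ∧ x ≠ v := by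
    intro x hx
    have h1 := hcov x
    have h2 := hQS x hx
    refine ⟨by tauto, by tauto, ?_, ?_⟩
    · rintro rfl; exact h2 hu
    · rintro rfl; exact h2 hv
  have vends : ∀ {S₁ S₂ : Finset V} {a b c d : V}, SpanPath G S₁ a b → SpanPath G S₂ d c →
      Disjoint S₁ S₂ → (∀ x, x ∈ S₁ ∨ x ∈ S₂ ↔ x ∈ S ∧ x ≠ u ∧ x ≠ v) → G.Adj u a → G.Adj u c →
      G.Adj b d → ¬ G.Adj v a := by
    intro S₁ S₂ a b c d h₁ h₂ hd hcov hua huc hbd hva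
    have hu₁₂ := hcov u
    have hv₁₂ := hcov v
    simp only [ne_eq, not_true_eq_false, false_and, and_false, iff_false, not_or] at hu₁₂ hv₁₂
    refine long ((((SpanPath.cons (x := u) ?_ h0 hQ).concat (x := v) ?_ hfv).append h₁ ?_
      hva).append h₂ ?_ hbd) huc.symm ?_ (z := f 0) ?_ hf0
    · exact fun h => hQS u h hu
    · rw [Finset.mem_insert, not_or]
      exact ⟨hvu, fun h => hQS v h hv⟩
    · simp only [Finset.disjoint_insert_left]
      refine ⟨hv₁₂.1, hu₁₂.1, Finset.disjoint_left.2 fun x hx hx' => ?_⟩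
      exact hQS x hx ((hcov x).1 (.inl hx')).1
    · simp only [Finset.disjoint_insert_left, Finset.disjoint_union_left]
      refine ⟨⟨hv₁₂.2, hu₁₂.2, Finset.disjoint_left.2 fun x hx hx' => ?_⟩, hd⟩
      exact hQS x hx ((hcov x).1 (.inr hx')).1
    · intro x hx
      have := hcov x
      simp only [Finset.mem_insert, Finset.mem_union]
      tauto
    · simp [hQ.left_mem]
  have nva : ¬ G.Adj v a := vends h₁ h₂ hd' hcov hua huc hbbd
  have nvc : ¬ G.Adj v c := vends h₂.symm h₁.symm hd'.symm (fun x => or_comm.trans (hcov x)) huc hua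
    hbbd.symm
  have hcu : IsCore G u := .of_adj (hne haS) (hne hcS) hac h0 hua huc
  have hcv : IsCore G v := .of_adj (hne' hbS) (hne' hdS) hbd hfv.symm hbv.symm hvd
  have hca : IsCore G a := by
    rcases h₁.eq_or_cons with ⟨-, rfl⟩ | ⟨a', haa', h₁'⟩
    · exact absurd hbv.symm nva
    · have ha' := Finset.mem_of_mem_erase h₁'.left_mem
      exact .of_adj huc.ne (ne_of_mem_of_not_mem ha' hu₁₂.1).symm
        (fun h => Finset.disjoint_left.1 hd' ha' (h ▸ h₂.right_mem)) hua.symm haac haa'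
  have hcc : IsCore G c := by
    rcases h₂.eq_or_concat with ⟨-, rfl⟩ | ⟨c', hcc', h₂'⟩
    · exact absurd hvd nvc
    · have hc' := Finset.mem_of_mem_erase h₂'.right_mem
      exact .of_adj hua.ne (ne_of_mem_of_not_mem hc' hu₁₂.2).symm
        (fun h => Finset.disjoint_left.1 hd' h₁.left_mem (h ▸ hc')) huc.symm haac.symm hcc'.symm
  obtain ⟨l, hl⟩ := hG.exists_isLink hcu
  have hal : a ≠ l := by
    rintro rfl
    exact hl.not_adj c hcc huc hac.symm haac.symm
  have hcl : c ≠ l := by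
    rintro rfl
    exact hl.not_adj a hca hua hac haac
  have hvl : G.Adj u v → v = l := by
    intro huv
    by_contra h
    exact nva (hl.clique v a hcv hca huv hua h hal hva)
  have hfl : IsCore G (f 0) → f 0 = l := by
    intro hcf
    by_contra h
    exact hf0a (hl.clique _ a hcf hca h0 hua h hal (hne haS))
  have hlQ : l ∈ Q ∨ l = v := by
    by_cases hcf : IsCore G (f 0)
    · exact .inl (hfl hcf ▸ hQ.left_mem)
    rw [IsCore, not_not] at hcf
    obtain ⟨s, t, hst, hN⟩ := hcf
    right
    have hw : ∀ w, G.Adj (f 0) w → w ≠ u → G.Adj u w := by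
      intro w hw hwu
      have h1 := (hN w).1 hw
      have h2 := (hN u).1 h0.symm
      have h3 := hst.symm
      grind
    rcases Nat.eq_zero_or_pos n with rfl | hn
    · exact (hvl (hw v hfv hvu)).symm
    · have h1 : G.Adj (f 0) (f 1) := (hadj 0 (by omega) 1 hn).2 (.inl rfl)
      have := hfu 1 hn (hw _ h1 (fun h => hfS 1 hn (h ▸ hu)))
      omega
  refine ⟨u, l, a, hl, hcu, ⟨hca, hua, hal⟩, fun u₁ hcu₁ huu₁ hu₁l E hE hEcl => ?_⟩
  have hu₁v : u₁ ≠ v := by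
    rintro rfl
    exact hu₁l (hvl huu₁)
  have hu₁Q : u₁ ∉ Q := by
    intro h
    obtain ⟨i, hi, rfl⟩ := (hmemQ u₁).1 h
    obtain rfl := hfu i hi huu₁
    exact hu₁l (hfl hcu₁)
  have reach : ∀ {R : Finset V} {r s : V}, SpanPath G R r s → IsCore G r → G.Adj u r → r ≠ l →
      G.Adj s v → u₁ ∉ R → (∀ x ∈ R, x ≠ u ∧ x ≠ v ∧ x ∉ Q) → l ∈ E := by
    intro R r s hR hcr hur hrl hsv hu₁R hRn
    have hW := (hR.concat (fun h => (hRn v h).2.1 rfl) hsv).append hQ.symm (by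
      rw [Finset.disjoint_insert_left, Finset.disjoint_left]
      exact ⟨fun h => hQS v h hv, fun x hx => (hRn x hx).2.2⟩) hfv.symm
    refine hW.core_subset_of_closed
      (hE r hcr hur hrl (ne_of_mem_of_not_mem hR.left_mem hu₁R)) (fun x hx y hy hcy hxy =>
        hEcl x hx y hcy ?_ ?_ hxy) l ?_ hl.core
    · rintro rfl
      simp only [Finset.mem_union, Finset.mem_insert] at hy
      rcases hy with (h | h) | h
      exacts [hvu h.symm, (hRn _ h).1 rfl, hQS _ h hu]
    · rintro rfl
      simp only [Finset.mem_union, Finset.mem_insert] at hy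
      rcases hy with (h | h) | h
      exacts [hu₁v h, hu₁R h, hu₁Q h]
    · rcases hlQ with h | rfl
      · simp [h]
      · simp
  by_cases hu₁S : u₁ ∈ S₁
  · refine reach h₂.symm hcc huc hcl hvd.symm (fun h => Finset.disjoint_left.1 hd' hu₁S h)
      fun x hx => ⟨?_, ?_, fun h => (hQ' x h).2.1 hx⟩
    · rintro rfl; exact hu₁₂.2 hx
    · rintro rfl; exact hv₁₂.2 hx
  · refine reach h₁ hca hua hal hbv hu₁S fun x hx => ⟨?_, ?_, fun h => (hQ' x h).1 hx⟩
    · rintro rfl; exact hu₁₂.1 hx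
    · rintro rfl; exact hv₁₂.1 hx

end Ear

section Prism

variable {V : Type*} [DecidableEq V] {G : SimpleGraph V}

/-- Two triangles joined by three pairwise disjoint paths `f i 0, …, f i (L i)` without further
adjacencies. -/
structure IsPrism (G : SimpleGraph V) (L : Fin 3 → ℕ) (f : Fin 3 → ℕ → V) : Prop where
  pos : ∀ i, 1 ≤ L i
  inj : ∀ i j s t, s ≤ L i → t ≤ L j → f i s = f j t → i = j ∧ s = t
  adj_self : ∀ i s t, s ≤ L i → t ≤ L i → (G.Adj (f i s) (f i t) ↔ s + 1 = t ∨ t + 1 = s)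
  adj_ne : ∀ i j s t, i ≠ j → s ≤ L i → t ≤ L j →
    (G.Adj (f i s) (f j t) ↔ s = 0 ∧ t = 0 ∨ s = L i ∧ t = L j)

theorem isPrism_of_paths {a b c : ℕ} {p q r : ℕ → V} (ha : 1 ≤ a) (hb : 1 ≤ b) (hc : 1 ≤ c)
    (hp : ∀ s t, s ≤ a → t ≤ a → p s = p t → s = t)
    (hq : ∀ s t, s ≤ b → t ≤ b → q s = q t → s = t)
    (hr : ∀ s t, s ≤ c → t ≤ c → r s = r t → s = t)
    (hpq : ∀ s t, s ≤ a → t ≤ b → p s ≠ q t) (hpr : ∀ s t, s ≤ a → t ≤ c → p s ≠ r t)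
    (hqr : ∀ s t, s ≤ b → t ≤ c → q s ≠ r t)
    (hpp' : ∀ s t, s ≤ a → t ≤ a → (G.Adj (p s) (p t) ↔ s + 1 = t ∨ t + 1 = s))
    (hqq' : ∀ s t, s ≤ b → t ≤ b → (G.Adj (q s) (q t) ↔ s + 1 = t ∨ t + 1 = s))
    (hrr' : ∀ s t, s ≤ c → t ≤ c → (G.Adj (r s) (r t) ↔ s + 1 = t ∨ t + 1 = s))
    (hpq' : ∀ s t, s ≤ a → t ≤ b → (G.Adj (p s) (q t) ↔ s = 0 ∧ t = 0 ∨ s = a ∧ t = b))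
    (hpr' : ∀ s t, s ≤ a → t ≤ c → (G.Adj (p s) (r t) ↔ s = 0 ∧ t = 0 ∨ s = a ∧ t = c))
    (hqr' : ∀ s t, s ≤ b → t ≤ c → (G.Adj (q s) (r t) ↔ s = 0 ∧ t = 0 ∨ s = b ∧ t = c)) :
    IsPrism G ![a, b, c] ![p, q, r] := by
  have flip : ∀ {a b : ℕ} {p q : ℕ → V},
      (∀ s t, s ≤ a → t ≤ b → (G.Adj (p s) (q t) ↔ s = 0 ∧ t = 0 ∨ s = a ∧ t = b)) →
      ∀ s t, s ≤ b → t ≤ a → (G.Adj (q s) (p t) ↔ s = 0 ∧ t = 0 ∨ s = b ∧ t = a) := by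
    intro a b p q h s t hs ht
    rw [G.adj_comm, h t s ht hs]
    tauto
  constructor
  · intro i
    fin_cases i <;> assumption
  · intro i j s t hs ht h
    fin_cases i <;> fin_cases j
    · exact ⟨rfl, hp s t hs ht h⟩
    · exact absurd h (hpq s t hs ht)
    · exact absurd h (hpr s t hs ht)
    · exact absurd h.symm (hpq t s ht hs)
    · exact ⟨rfl, hq s t hs ht h⟩
    · exact absurd h (hqr s t hs ht)
    · exact absurd h.symm (hpr t s ht hs)
    · exact absurd h.symm (hqr t s ht hs)
    · exact ⟨rfl, hr s t hs ht h⟩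
  · intro i
    fin_cases i <;> assumption
  · intro i j s t hij
    fin_cases i <;> fin_cases j
    · exact absurd rfl hij
    · exact hpq' s t
    · exact hpr' s t
    · exact flip hpq' s t
    · exact absurd rfl hij
    · exact hqr' s t
    · exact flip hpr' s t
    · exact flip hqr' s t
    · exact absurd rfl hij

variable [Fintype V]

/-- A minimal non-hamiltonian graph contains an induced prism made of core vertices. -/
theorem IsMinimalNonhamiltonian.exists_isPrism (hG : IsMinimalNonhamiltonian G) :
    ∃ L f, IsPrism G L f ∧ ∀ i s, s ≤ L i → IsCore G (f i s) := by
  obtain ⟨u, l, u₀, hl, hcu, ⟨hcu₀, huu₀, hu₀l⟩, hdet⟩ := hG.exists_detour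
  obtain ⟨g, n, hg0, hgn, hgS, -, hgK, hginj, hgadj⟩ := exists_shortest_path G
    {a | IsCore G a ∧ a ≠ u} {l} {a | IsCore G a ∧ G.Adj u a ∧ a ≠ l} fun D hDS hlD hcl => by
      by_contra hn
      have hlD' : l ∈ D := hlD ⟨rfl, hl.core, hl.adj.ne'⟩
      have hKD : ∀ a, IsCore G a → G.Adj u a → a ≠ l → a ∉ D := fun a h1 h2 h3 h4 =>
        hn ⟨a, h4, h1, h2, h3⟩
      have := hdet u₀ hcu₀ huu₀ hu₀l {a | IsCore G a ∧ a ≠ u ∧ a ∉ D}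
        (fun a h1 h2 h3 _ => ⟨h1, h2.ne', hKD a h1 h2 h3⟩)
        (fun a ha b hb hbu _ hab => ⟨hb, hbu, fun hbD =>
          ha.2.2 (hcl b hbD a ⟨ha.1, ha.2.1⟩ hab.symm)⟩)
      exact this.2.2 hlD'
  obtain rfl : g 0 = l := hg0
  obtain ⟨hcgn, hugn, hgn0⟩ := hgn
  have hgc : ∀ i ≤ n, IsCore G (g i) := fun i hi => (hgS i hi).1
  have hgu : ∀ i ≤ n, g i ≠ u := fun i hi => (hgS i hi).2
  have hn : 2 ≤ n := by
    have h0 : n ≠ 0 := by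
      rintro rfl
      exact hgn0 rfl
    have h1 : n ≠ 1 := by
      rintro rfl
      exact hl.not_adj _ hcgn hugn hgn0 ((hgadj 1 le_rfl 0 (by omega)).2 (.inr rfl))
    omega
  have hug : ∀ i ≤ n, (G.Adj u (g i) ↔ i = 0 ∨ i = n) := by
    intro i hi
    constructor
    · intro h
      by_cases hi0 : i = 0
      · exact .inl hi0
      · refine .inr (hgK i hi ⟨hgc i hi, h, fun h' => hi0 (hginj i hi 0 (by omega) h')⟩)
    · rintro (rfl | rfl)
      exacts [hl.adj, hugn]
  obtain ⟨h, m, hh0, hhm, hhS, hhA, hhB, hhinj, hhadj⟩ := exists_shortest_path G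
    {a | IsCore G a ∧ a ≠ u ∧ ∀ i ≤ n, a ≠ g i} {a | IsCore G a ∧ G.Adj u a ∧ a ≠ g 0 ∧ a ≠ g n}
    {a | ∃ i < n, G.Adj a (g i)} fun D hDS hD hcl => by
      by_contra hno
      have := hdet (g n) hcgn hugn hgn0 D (fun a h1 h2 h3 h4 => hD ⟨⟨h1, h2, h3, h4⟩, h1, h2.ne',
        fun i hi hai => by
          subst hai
          rcases (hug i hi).1 h2 with rfl | rfl
          exacts [h3 rfl, h4 rfl]⟩) (fun a ha b hb hbu hbg hab => by
          by_cases hbZ : ∃ i ≤ n, b = g i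
          · obtain ⟨i, hi, rfl⟩ := hbZ
            have : i < n := lt_of_le_of_ne hi (fun h' => hbg (h' ▸ rfl))
            exact absurd ⟨a, ha, i, this, hab⟩ hno
          · push Not at hbZ
            exact hcl a ha b ⟨hb, hbu, hbZ⟩ hab)
      exact (hDS this).2.2 0 (by omega) rfl
  have hhc : ∀ i ≤ m, IsCore G (h i) := fun i hi => (hhS i hi).1
  have hhu : ∀ i ≤ m, h i ≠ u := fun i hi => (hhS i hi).2.1
  have hhg : ∀ i ≤ m, ∀ j ≤ n, h i ≠ g j := fun i hi => (hhS i hi).2.2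
  obtain ⟨-, huh0, -, -⟩ := hh0
  have huh : ∀ i ≤ m, (G.Adj u (h i) ↔ i = 0) := by
    intro i hi
    constructor
    · exact fun h' => hhA i hi ⟨hhc i hi, h', hhg i hi 0 (by omega), hhg i hi n le_rfl⟩
    · rintro rfl
      exact huh0
  have hgnh0 : G.Adj (g n) (h 0) := hl.clique _ _ hcgn (hhc 0 (by omega)) hugn huh0 hgn0
    (hhg 0 (by omega) 0 (by omega)) (hhg 0 (by omega) n le_rfl).symm
  have hgnl : IsLink G (g n) (g (n - 1)) := by
    obtain ⟨l', hl'⟩ := hG.exists_isLink hcgn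
    have h1 : l' ≠ u := by
      rintro rfl
      exact hl'.not_adj (h 0) (hhc 0 (by omega)) hgnh0 (hhu 0 (by omega)) huh0.symm
    by_cases h2 : g (n - 1) = l'
    · rwa [h2]
    · exfalso
      have := hl'.clique u (g (n - 1)) hcu (hgc _ (by omega)) hugn.symm
        ((hgadj n le_rfl (n - 1) (by omega)).2 (by omega)) h1.symm h2 (hgu _ (by omega)).symm
      rw [hug _ (by omega)] at this
      omega
  have hgnh : ∀ i ≤ m, (G.Adj (g n) (h i) ↔ i = 0) := by
    intro i hi
    constructor
    · intro h'
      have hun : u ≠ g (n - 1) := (hgu _ (by omega)).symm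
      exact (huh i hi).1 (hgnl.clique u (h i) hcu (hhc i hi) hugn.symm h' hun
        (hhg i hi _ (by omega)) (hhu i hi).symm)
    · rintro rfl
      exact hgnh0
  have hgjh0 : ∀ j < n, ¬ G.Adj (g j) (h 0) := by
    intro j hj hadj
    obtain ⟨l', hl'⟩ := hG.exists_isLink (hhc 0 (by omega))
    have hj0 : j ≠ 0 := by
      rintro rfl
      exact hl.not_adj _ (hhc 0 (by omega)) huh0 (hhg 0 (by omega) 0 (by omega)) hadj.symm
    have huj : ¬ G.Adj u (g j) := by
      rw [hug j hj.le]
      omega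
    have h1 : l' ≠ u := by
      rintro rfl
      exact hl'.not_adj (g n) hcgn hgnh0.symm (hgu n le_rfl) hugn.symm
    obtain rfl : g j = l' := by
      by_contra h2
      exact huj (hl'.clique u (g j) hcu (hgc j hj.le) huh0.symm hadj.symm h1.symm h2
        (hgu j hj.le).symm)
    have hother : ∀ i ≤ n, G.Adj (g i) (g j) → ¬ G.Adj (h 0) (g i) := fun i hi h1 h2 =>
      hl'.not_adj (g i) (hgc i hi) h2 h1.ne h1
    have hm1 := (hgadj (j - 1) (by omega) j hj.le).2 (by omega)
    have hp1 := (hgadj (j + 1) (by omega) j hj.le).2 (by omega)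
    have := hG.clawFree.adj_of_not_adj (hhg 0 (by omega) (j - 1) (by omega))
      (hhg 0 (by omega) (j + 1) (by omega)) (fun h' => by
        have := hginj (j - 1) (by omega) (j + 1) (by omega) h'
        omega) hadj hm1.symm hp1.symm (hother _ (by omega) hm1) (hother _ (by omega) hp1)
    rw [hgadj _ (by omega) _ (by omega)] at this
    omega
  have hm : 1 ≤ m := by
    by_contra hm
    obtain rfl : m = 0 := by omega
    obtain ⟨i, hi, h'⟩ := hhm
    exact hgjh0 i hi h'.symm
  have hgh : ∀ j < n, ∀ i ≤ m, G.Adj (g j) (h i) → i = m := fun j hj i hi h' =>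
    hhB i hi ⟨j, hj, h'.symm⟩
  obtain ⟨e, hen, he, he'⟩ : ∃ e, e + 1 < n ∧ G.Adj (g e) (h m) ∧ G.Adj (g (e + 1)) (h m) := by
    obtain ⟨j, hj, hmj⟩ := hhm
    by_cases hp1 : G.Adj (g (j + 1)) (h m)
    · refine ⟨j, ?_, hmj.symm, hp1⟩
      by_contra hjn
      obtain rfl : j + 1 = n := by omega
      have := (hgnh m le_rfl).1 hp1
      omega
    · have hjp := (hgadj (j + 1) (by omega) j hj.le).2 (by omega)
      rcases Nat.eq_zero_or_pos j with rfl | hj0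
      · exfalso
        have := hG.clawFree.adj_of_not_adj (hhg m le_rfl (0 + 1) (by omega)).symm
          (hgu (0 + 1) (by omega)) (hhu m le_rfl) hjp.symm hmj.symm hl.adj.symm hp1
          (fun h' => by
            have := (hug _ (by omega)).1 h'.symm
            omega)
        have := (huh m le_rfl).1 this.symm
        omega
      · have hjm := (hgadj (j - 1) (by omega) j hj.le).2 (by omega)
        refine ⟨j - 1, by omega, ?_, by rwa [Nat.sub_add_cancel hj0, G.adj_comm]⟩
        have := hG.clawFree.adj_of_not_adj (hhg m le_rfl (j + 1) (by omega)).symm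
          (fun h' => by
            have := hginj (j + 1) (by omega) (j - 1) (by omega) h'
            omega) (hhg m le_rfl (j - 1) (by omega)) hjp.symm hmj.symm hjm.symm hp1
          (fun h' => by
            rw [hgadj _ (by omega) _ (by omega)] at h'
            omega)
        exact this.symm
  have hJ : ∀ j < n, G.Adj (g j) (h m) → j = e ∨ j = e + 1 := by
    intro j hj hjm
    obtain ⟨l', hl'⟩ := hG.exists_isLink (hhc m le_rfl)
    have hmm : G.Adj (h m) (h (m - 1)) := (hhadj m le_rfl (m - 1) (by omega)).2 (by omega)
    have hgl : h (m - 1) ≠ l' → ∀ i < n, G.Adj (g i) (h m) → g i = l' := by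
      intro hne i hi him
      by_contra hil
      have := hgh i hi (m - 1) (by omega) (hl'.clique _ _ (hgc i hi.le) (hhc _ (by omega)) him.symm
        hmm hil hne (hhg _ (by omega) i hi.le).symm)
      omega
    obtain rfl : h (m - 1) = l' := by
      by_contra hne
      have := hginj e (by omega) (e + 1) (by omega)
        ((hgl hne e (by omega) he).trans (hgl hne (e + 1) hen he').symm)
      omega
    have hcl : ∀ i < n, G.Adj (g i) (h m) → i ≠ j → i + 1 = j ∨ j + 1 = i := by
      intro i hi him hij
      exact (hgadj i hi.le j hj.le).1 (hl'.clique _ _ (hgc i hi.le) (hgc j hj.le) him.symm hjm.symm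
        (hhg _ (by omega) i hi.le).symm (hhg _ (by omega) j hj.le).symm
        fun h' => hij (hginj i hi.le j hj.le h'))
    have h1 := hcl e (by omega) he
    have h2 := hcl (e + 1) hen he'
    omega
  have hcross : ∀ j ≤ n, ∀ i ≤ m, (G.Adj (g j) (h i) ↔
      j = n ∧ i = 0 ∨ (j = e ∨ j = e + 1) ∧ i = m) := by
    intro j hj i hi
    rcases hj.lt_or_eq with hjn | rfl
    · constructor
      · intro h'
        obtain rfl := hgh j hjn i hi h'
        exact .inr ⟨hJ j hjn h', rfl⟩
      · rintro (h' | ⟨rfl | rfl, rfl⟩)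
        exacts [by omega, he, he']
    · rw [hgnh i hi]
      omega
  refine ⟨![e + 1, n - 1 - e, m], ![fun s => if s = 0 then u else g (s - 1), fun s => g (n - s), h],
    isPrism_of_paths (by omega) (by omega) hm ?_ ?_ ?_ ?_ ?_ ?_ ?_ ?_ ?_ ?_ ?_ ?_, ?_⟩
  · intro s t hs ht hst
    by_cases hs0 : s = 0 <;> by_cases ht0 : t = 0 <;> simp only [hs0, ht0, if_true, if_false] at hst
    · omega
    · exact absurd hst.symm (hgu _ (by omega))
    · exact absurd hst (hgu _ (by omega))
    · have := hginj _ (by omega) _ (by omega) hst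
      omega
  · intro s t hs ht hst
    have := hginj _ (by omega) _ (by omega) hst
    omega
  · exact fun s t hs ht hst => hhinj s hs t ht hst
  · intro s t hs ht hst
    by_cases hs0 : s = 0 <;> simp only [hs0, if_true, if_false] at hst
    · exact hgu _ (by omega) hst.symm
    · have := hginj _ (by omega) _ (by omega) hst
      omega
  · intro s t hs ht hst
    by_cases hs0 : s = 0 <;> simp only [hs0, if_true, if_false] at hst
    · exact hhu _ ht hst.symm
    · exact hhg t ht _ (by omega) hst.symm
  · intro s t hs ht hst
    exact hhg t ht _ (by omega) hst.symm
  · intro s t hs ht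
    by_cases hs0 : s = 0 <;> by_cases ht0 : t = 0 <;> simp only [hs0, ht0, if_true, if_false]
    · simp
    · rw [hug _ (by omega)]
      omega
    · rw [G.adj_comm, hug _ (by omega)]
      omega
    · rw [hgadj _ (by omega) _ (by omega)]
      omega
  · intro s t hs ht
    rw [hgadj _ (by omega) _ (by omega)]
    omega
  · exact fun s t hs ht => hhadj s hs t ht
  · intro s t hs ht
    by_cases hs0 : s = 0 <;> simp only [hs0, if_true, if_false, true_and, false_and, false_or]
    · rw [hug _ (by omega)]
      omega
    · rw [hgadj _ (by omega) _ (by omega)]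
      omega
  · intro s t hs ht
    by_cases hs0 : s = 0 <;> simp only [hs0, if_true, if_false, true_and, false_and, false_or]
    · rw [huh _ ht]
      omega
    · rw [hcross _ (by omega) _ ht]
      omega
  · intro s t hs ht
    rw [hcross _ (by omega) _ ht]
    omega
  · intro i s hs
    fin_cases i
    · by_cases hs0 : s = 0
      · simpa [hs0] using hcu
      · have : s ≤ e + 1 := hs
        simpa [hs0] using hgc (s - 1) (by omega)
    · exact hgc _ (by omega)
    · exact hhc _ hs

end Prism

section Member

variable {V : Type*} [DecidableEq V] {G : SimpleGraph V}

/-- The paths `f i 0, …, f i (k i + 1)`, closed to a triangle if `t i`, form an induced member of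
Brousek's family. -/
structure IsBrousekData (G : SimpleGraph V) (t : Fin 3 → Bool) (k : Fin 3 → ℕ)
    (f : Fin 3 → ℕ → V) : Prop where
  pos : ∀ i, 1 ≤ k i
  eq_one : ∀ i, t i = true → k i = 1
  inj : ∀ i j r s, r ≤ k i + 1 → s ≤ k j + 1 → f i r = f j s → i = j ∧ r = s
  adj_self : ∀ i r s, r ≤ k i + 1 → s ≤ k i + 1 → (G.Adj (f i r) (f i s) ↔
    r + 1 = s ∨ s + 1 = r ∨ t i = true ∧ (r = 0 ∧ s = 2 ∨ r = 2 ∧ s = 0))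
  adj_ne : ∀ i j r s, i ≠ j → r ≤ k i + 1 → s ≤ k j + 1 →
    (G.Adj (f i r) (f j s) ↔ r = 0 ∧ s = 0 ∨ r = k i + 1 ∧ s = k j + 1)

theorem IsBrousekData.map {W : Type*} [DecidableEq W] {H : SimpleGraph W} {t : Fin 3 → Bool}
    {k : Fin 3 → ℕ} {f : Fin 3 → ℕ → W} (h : IsBrousekData H t k f) (e : H ↪g G) :
    IsBrousekData G t k fun i r => e (f i r) where
  pos := h.pos
  eq_one := h.eq_one
  inj i j r s hr hs hrs := h.inj i j r s hr hs (e.injective hrs)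
  adj_self i r s hr hs := by rw [e.map_adj_iff, h.adj_self i r s hr hs]
  adj_ne i j r s hij hr hs := by rw [e.map_adj_iff, h.adj_ne i j r s hij hr hs]

theorem IsBrousekData.exists_isBrousekMember {t : Fin 3 → Bool} {k : Fin 3 → ℕ}
    {f : Fin 3 → ℕ → V} (h : IsBrousekData G t k f) :
    ∃ s : Set V, IsBrousekMember (G.induce s) := by
  refine ⟨{v | ∃ i, ∃ r ≤ k i + 1, f i r = v}, ?_⟩
  set S : Set V := {v | ∃ i, ∃ r ≤ k i + 1, f i r = v} with hS
  let F : Fin 3 → ℕ → S := fun i r =>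
    ⟨f i (min r (k i + 1)), i, min r (k i + 1), min_le_right _ _, rfl⟩
  have hF : ∀ i r, r ≤ k i + 1 → (F i r : V) = f i r := fun i r hr => by
    simp only [F, min_eq_left hr]
  have hinj : ∀ i j r s, r ≤ k i + 1 → s ≤ k j + 1 → F i r = F j s → i = j ∧ r = s := by
    intro i j r s hr hs hrs
    refine h.inj i j r s hr hs ?_
    rw [← hF i r hr, ← hF j s hs, hrs]
  have hsurj : ∀ v : S, ∃ i, ∃ r ≤ k i + 1, F i r = v := by
    rintro ⟨_, i, r, hr, rfl⟩
    exact ⟨i, r, hr, Subtype.ext (hF i r hr)⟩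
  have hself : ∀ i r s, r ≤ k i + 1 → s ≤ k i + 1 → ((G.induce S).Adj (F i r) (F i s) ↔
      r + 1 = s ∨ s + 1 = r ∨ t i = true ∧ (r = 0 ∧ s = 2 ∨ r = 2 ∧ s = 0)) := by
    intro i r s hr hs
    rw [SimpleGraph.comap_adj, Function.Embedding.subtype_apply, Function.Embedding.subtype_apply,
      hF i r hr, hF i s hs, h.adj_self i r s hr hs]
  have hne : ∀ i j r s, i ≠ j → r ≤ k i + 1 → s ≤ k j + 1 →
      ((G.induce S).Adj (F i r) (F j s) ↔ r = 0 ∧ s = 0 ∨ r = k i + 1 ∧ s = k j + 1) := by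
    intro i j r s hij hr hs
    rw [SimpleGraph.comap_adj, Function.Embedding.subtype_apply, Function.Embedding.subtype_apply,
      hF i r hr, hF j s hs, h.adj_ne i j r s hij hr hs]
  clear_value F
  refine ⟨fun i => F i 0, fun i => F i (k i + 1), t, k, fun i j => F i (j + 1), h.pos, h.eq_one,
    ⟨?_, ?_⟩, ?_⟩
  · rintro ((i | i) | ⟨i, r⟩) ((j | j) | ⟨j, s⟩) hij
    · rw [(hinj i j 0 0 (by omega) (by omega) hij).1]
    · have := (hinj i j 0 (k j + 1) (by omega) (by omega) hij).2
      omega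
    · have := (hinj i j 0 (s + 1) (by omega) (by omega) hij).2
      omega
    · have := (hinj i j (k i + 1) 0 (by omega) (by omega) hij).2
      omega
    · rw [(hinj i j (k i + 1) (k j + 1) (by omega) (by omega) hij).1]
    · obtain ⟨rfl, h'⟩ := hinj i j (k i + 1) (s + 1) (by omega) (by omega) hij
      omega
    · have := (hinj i j (r + 1) 0 (by omega) (by omega) hij).2
      omega
    · obtain ⟨rfl, h'⟩ := hinj i j (r + 1) (k j + 1) (by omega) (by omega) hij
      omega
    · obtain ⟨rfl, h'⟩ := hinj i j (r + 1) (s + 1) (by omega) (by omega) hij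
      obtain rfl : r = s := by
        ext
        omega
      rfl
  · intro v
    obtain ⟨i, r, hr, rfl⟩ := hsurj v
    rcases Nat.eq_zero_or_pos r with rfl | hr0
    · exact ⟨.inl (.inl i), rfl⟩
    rcases hr.eq_or_lt with rfl | hrk
    · exact ⟨.inl (.inr i), rfl⟩
    · refine ⟨.inr ⟨i, ⟨r - 1, by omega⟩⟩, ?_⟩
      change F i (r - 1 + 1) = F i r
      rw [Nat.sub_add_cancel hr0]
  · intro x y
    have step : ∀ i r, r ≤ k i → BrousekSpec (fun i => F i 0) (fun i => F i (k i + 1)) t k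
        (fun i j => F i (j + 1)) (F i r) (F i (r + 1)) := by
      intro i r hr
      rcases Nat.eq_zero_or_pos r with rfl | hr0
      · exact .inr (.inr (.inr (.inl ⟨i, rfl, rfl⟩)))
      rcases hr.eq_or_lt with rfl | hrk
      · refine .inr (.inr (.inr (.inr (.inr ⟨i, ?_, rfl⟩))))
        simp only [Nat.sub_add_cancel hr0]
      · refine .inr (.inr (.inr (.inr (.inl ⟨i, r - 1, by omega, ?_, ?_⟩))))
        · simp only [Nat.sub_add_cancel hr0]
        · simp only [Nat.sub_add_cancel hr0]
    have hspec : ∀ x y, BrousekSpec (fun i => F i 0) (fun i => F i (k i + 1)) t k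
        (fun i j => F i (j + 1)) x y → (G.induce S).Adj x y := by
      rintro x y (⟨i, j, hij, rfl, rfl⟩ | ⟨i, j, hij, rfl, rfl⟩ | ⟨i, hi, rfl, rfl⟩ |
        ⟨i, rfl, rfl⟩ | ⟨i, j, hj, rfl, rfl⟩ | ⟨i, rfl, rfl⟩)
      · exact (hne i j _ _ hij (by omega) (by omega)).2 (.inl ⟨rfl, rfl⟩)
      · exact (hne i j _ _ hij (by omega) (by omega)).2 (.inr ⟨rfl, rfl⟩)
      · refine (hself i _ _ (by omega) (by omega)).2 (.inr (.inr ⟨hi, .inl ⟨rfl, ?_⟩⟩))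
        rw [h.eq_one i hi]
      · exact (hself i _ _ (by omega) (by omega)).2 (.inl rfl)
      · exact (hself i _ _ (by omega) (by omega)).2 (.inl rfl)
      · have := h.pos i
        exact (hself i _ _ (by omega) (by omega)).2 (.inl (by omega))
    constructor
    · intro hxy
      obtain ⟨i, r, hr, rfl⟩ := hsurj x
      obtain ⟨j, s, hs, rfl⟩ := hsurj y
      by_cases hij : i = j
      · subst hij
        rcases (hself i r s hr hs).1 hxy with rfl | rfl | ⟨ht, ⟨rfl, rfl⟩ | ⟨rfl, rfl⟩⟩
        · exact .inl (step i r (by omega))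
        · exact .inr (step i s (by omega))
        · refine .inl (.inr (.inr (.inl ⟨i, ht, rfl, ?_⟩)))
          simp only [h.eq_one i ht]
        · refine .inr (.inr (.inr (.inl ⟨i, ht, rfl, ?_⟩)))
          simp only [h.eq_one i ht]
      · rcases (hne i j r s hij hr hs).1 hxy with ⟨rfl, rfl⟩ | ⟨rfl, rfl⟩
        · exact .inl (.inl ⟨i, j, hij, rfl, rfl⟩)
        · exact .inl (.inr (.inl ⟨i, j, hij, rfl, rfl⟩))
    · rintro (hxy | hxy)
      exacts [hspec x y hxy, (hspec y x hxy).symm]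

variable [Fintype V]

/-- In a prism of core vertices, a path of length one has a common neighbour of degree two. -/
theorem IsPrism.exists_apex (hG : IsMinimalNonhamiltonian G) {L : Fin 3 → ℕ} {f : Fin 3 → ℕ → V}
    (hf : IsPrism G L f) (hc : ∀ i s, s ≤ L i → IsCore G (f i s)) {i : Fin 3} (hi : L i = 1) :
    ∃ p, ∀ w, G.Adj p w ↔ w = f i 0 ∨ w = f i 1 := by
  obtain ⟨j, k, hij, hik, hjk⟩ : ∃ j k, i ≠ j ∧ i ≠ k ∧ j ≠ k :=
    (by decide : ∀ i : Fin 3, ∃ j k, i ≠ j ∧ i ≠ k ∧ j ≠ k) i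
  have hj := hf.pos j
  have hk := hf.pos k
  obtain ⟨l, hl⟩ := hG.exists_isLink (hc i 0 (by omega))
  have h01 : G.Adj (f i 0) (f i 1) :=
    (hf.adj_self i 0 1 (by omega) (by omega)).2 (.inl rfl)
  have h1l : f i 1 = l := by
    by_contra hne
    have key : ∀ j, i ≠ j → f j 0 = l := by
      intro j hij
      have hj := hf.pos j
      by_contra hjl
      have := hl.clique _ _ (hc i 1 hi.ge) (hc j 0 (by omega)) h01
        ((hf.adj_ne i j 0 0 hij (by omega) (by omega)).2 (.inl ⟨rfl, rfl⟩)) hne hjl (fun h =>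
          hij (hf.inj i j 1 0 (by omega) (by omega) h).1)
      rw [hf.adj_ne i j 1 0 hij (by omega) (by omega)] at this
      omega
    exact hjk (hf.inj j k 0 0 (by omega) (by omega) ((key j hij).trans (key k hik).symm)).1
  have hdeg : ∀ r r', r ≤ 1 → r' ≤ 1 → r ≠ r' →
      (∀ j, i ≠ j → ∃ s ≤ L j, G.Adj (f i r) (f j s)) →
      ¬ ∃ y, ∀ w, G.Adj (f i r) w → w = f i r' ∨ w = y := by
    rintro r r' hr hr' hrr' h ⟨y, hy⟩
    have key : ∀ j, i ≠ j → ∃ s ≤ L j, f j s = y := by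
      intro j hij
      obtain ⟨s, hs, h'⟩ := h j hij
      refine ⟨s, hs, (hy _ h').resolve_left fun h'' => ?_⟩
      exact hij (hf.inj j i s r' hs (by omega) h'').1.symm
    obtain ⟨s, hs, hs'⟩ := key j hij
    obtain ⟨s', ht, ht'⟩ := key k hik
    exact hjk (hf.inj j k s s' hs ht (hs'.trans ht'.symm)).1
  rcases hl.apex with h | h | h
  · rwa [h1l]
  · rw [← h1l] at h
    refine absurd h (hdeg 1 0 le_rfl (by omega) (by omega) fun j hij => ⟨L j, le_rfl, ?_⟩)
    exact (hf.adj_ne i j 1 (L j) hij (by omega) le_rfl).2 (.inr ⟨hi.symm, rfl⟩)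
  · rw [← h1l] at h
    refine absurd h (hdeg 0 1 (by omega) le_rfl (by omega) fun j hij => ⟨0, by omega, ?_⟩)
    exact (hf.adj_ne i j 0 0 hij (by omega) (by omega)).2 (.inl ⟨rfl, rfl⟩)

theorem IsMinimalNonhamiltonian.exists_isBrousekData (hG : IsMinimalNonhamiltonian G) :
    ∃ t k f, IsBrousekData G t k f := by
  obtain ⟨L, f, hf, hc⟩ := hG.exists_isPrism
  have key : ∀ i, ∃ (t : Bool) (k : ℕ) (q : ℕ → V), 1 ≤ k ∧ (t = true → k = 1) ∧
      (∀ r s, r ≤ k + 1 → s ≤ k + 1 → q r = q s → r = s) ∧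
      (∀ r s, r ≤ k + 1 → s ≤ k + 1 → (G.Adj (q r) (q s) ↔
        r + 1 = s ∨ s + 1 = r ∨ t = true ∧ (r = 0 ∧ s = 2 ∨ r = 2 ∧ s = 0))) ∧
      ∀ r ≤ k + 1, (∃ r' ≤ L i, q r = f i r' ∧ (r' = 0 ↔ r = 0) ∧ (r' = L i ↔ r = k + 1)) ∨
        (r ≠ 0 ∧ r ≠ k + 1 ∧ ¬ IsCore G (q r) ∧ ∀ w, G.Adj (q r) w ↔ w = f i 0 ∨ w = f i (L i)) := by
    intro i
    have hpos := hf.pos i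
    by_cases hi : L i = 1
    · obtain ⟨p, hp⟩ := hf.exists_apex hG hc hi
      have hpa := (hp _).2 (.inl rfl)
      have hpb := (hp _).2 (.inr rfl)
      have hab : G.Adj (f i 0) (f i 1) := (hf.adj_self i 0 1 (by omega) (by omega)).2 (.inl rfl)
      refine ⟨true, 1, fun r => if r = 0 then f i 0 else if r = 1 then p else f i 1, le_rfl,
        fun _ => rfl, ?_, ?_, ?_⟩
      · intro r s hr hs h
        have h1 := hpa.ne
        have h2 := hpb.ne
        have h3 := hab.ne
        interval_cases r <;> interval_cases s <;> simp_all
      · intro r s hr hs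
        interval_cases r <;> interval_cases s <;> simp [hpa, hpb, hab, hpa.symm, hpb.symm, hab.symm]
      · intro r hr
        interval_cases r
        · exact .inl ⟨0, by omega, by simp, by simp, by simp [hi]⟩
        · refine .inr ⟨by omega, by omega, fun h => h ⟨_, _, hab, ?_⟩, ?_⟩
          · simpa using hp
          · simpa [hi] using hp
        · exact .inl ⟨1, by omega, by simp, by simp, by simp [hi]⟩
    · refine ⟨false, L i - 1, f i, by omega, by simp, ?_, ?_, ?_⟩
      · exact fun r s hr hs h => (hf.inj i i r s (by omega) (by omega) h).2
      · intro r s hr hs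
        rw [hf.adj_self i r s (by omega) (by omega)]
        simp
      · exact fun r hr => .inl ⟨r, by omega, rfl, Iff.rfl, by omega⟩
  choose t k q hk ht hinj hadj hq using key
  have hcore : ∀ i, IsCore G (f i 0) ∧ IsCore G (f i (L i)) :=
    fun i => ⟨hc i 0 (by omega), hc i (L i) le_rfl⟩
  have hfne : ∀ i j r s, i ≠ j → r ≤ L i → s ≤ L j → f i r ≠ f j s :=
    fun i j r s hij hr hs h => hij (hf.inj i j r s hr hs h).1
  refine ⟨t, k, q, hk, ht, ?_, hadj, ?_⟩
  · intro i j r s hr hs h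
    by_cases hij : i = j
    · subst hij
      exact ⟨rfl, hinj i r s hr hs h⟩
    · exfalso
      rcases hq i r hr with ⟨r', hr', hqr, -⟩ | ⟨-, -, hqr, hN⟩ <;>
        rcases hq j s hs with ⟨s', hs', hqs, -⟩ | ⟨-, -, hqs, hM⟩
      · exact hfne i j r' s' hij hr' hs' (by rw [← hqr, ← hqs, h])
      · exact hqs (by rw [← h, hqr]; exact hc i r' hr')
      · exact hqr (by rw [h, hqs]; exact hc j s' hs')
      · have := (hN (f i 0)).2 (.inl rfl)
        rw [h, hM] at this
        rcases this with h' | h'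
        exacts [hfne i j _ _ hij (by omega) (by omega) h', hfne i j _ _ hij (by omega) le_rfl h']
  · intro i j r s hij hr hs
    rcases hq i r hr with ⟨r', hr', hqr, h1, h2⟩ | ⟨hr0, hrk, hqr, hN⟩ <;>
      rcases hq j s hs with ⟨s', hs', hqs, h3, h4⟩ | ⟨hs0, hsk, hqs, hM⟩
    · rw [hqr, hqs, hf.adj_ne i j r' s' hij hr' hs', h1, h2, h3, h4]
    · refine iff_of_false (fun h => ?_) (by omega)
      rw [G.adj_comm, hM, hqr] at h
      rcases h with h' | h'
      exacts [hfne i j _ _ hij hr' (by omega) h', hfne i j _ _ hij hr' le_rfl h']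
    · refine iff_of_false (fun h => ?_) (by omega)
      rw [hN, hqs] at h
      rcases h with h' | h'
      exacts [hfne j i _ _ (Ne.symm hij) hs' (by omega) h', hfne j i _ _ (Ne.symm hij) hs' le_rfl h']
    · refine iff_of_false (fun h => ?_) (by omega)
      rw [hN] at h
      rcases h with h' | h' <;> rw [h'] at hqs
      exacts [hqs (hcore i).1, hqs (hcore i).2]

/-- The graph induced on `S` has no cut vertex if `S` has none. -/
theorem NoCutVertex.comap {S : Finset V} (hS : NoCutVertex G S) :
    NoCutVertex (G.comap (Function.Embedding.subtype (· ∈ S))) Finset.univ := by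
  refine ⟨by simpa using hS.1, fun v _ X hX hne hcl c _ hcv => ?_⟩
  have := hS.2 v v.2 (Subtype.val '' X) (by
    rintro _ ⟨a, ha, rfl⟩
    exact ⟨a.2, fun h => (hX a ha).2 (Subtype.ext h)⟩) (hne.image _) (by
    rintro _ ⟨a, ha, rfl⟩ b hb hbv hab
    exact ⟨⟨b, hb⟩, hcl a ha ⟨b, hb⟩ (Finset.mem_univ _) (fun h => hbv (by rw [← h])) hab, rfl⟩)
    c c.2 (fun h => hcv (Subtype.ext h))
  obtain ⟨a, ha, hac⟩ := this
  rwa [← Subtype.ext hac]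

theorem SpanCycle.of_comap {S : Finset V}
    (h : SpanCycle (G.comap (Function.Embedding.subtype (· ∈ S))) Finset.univ) :
    SpanCycle G S := by
  obtain ⟨hc, a, b, hp, hab⟩ := h
  have := hp.map (G := G) (Function.Embedding.subtype (· ∈ S)) fun x y h => h
  have hS : Finset.univ.map (Function.Embedding.subtype (· ∈ S)) = S := by
    ext x
    simp
  rw [hS] at this
  exact ⟨by simpa using hc, a, b, this, hab⟩

end Member

theorem exists_isBrousekData_of_card (n : ℕ) : ∀ {V : Type*} [Fintype V] [DecidableEq V]
    (G : SimpleGraph V), Fintype.card V = n → ClawFree G → NoCutVertex G Finset.univ →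
    ¬ SpanCycle G Finset.univ → ∃ t k f, IsBrousekData G t k f := by
  induction n using Nat.strong_induction_on with
  | _ n ih =>
    intro V _ _ G hn hclaw hcut hham
    by_cases h : ∃ S, S ≠ Finset.univ ∧ NoCutVertex G S ∧ ¬ SpanCycle G S
    · obtain ⟨S, hS, hcutS, hhamS⟩ := h
      have hcard : Fintype.card {x // x ∈ S} < n := by
        rw [Fintype.card_coe, ← hn]
        exact (Finset.card_lt_iff_ne_univ S).2 hS
      obtain ⟨t, k, f, hf⟩ := ih _ hcard (G.comap (Function.Embedding.subtype (· ∈ S))) rfl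
        (fun a b c d hbc hbd hcd => hclaw a b c d (fun h => hbc (Subtype.ext h))
          (fun h => hbd (Subtype.ext h)) (fun h => hcd (Subtype.ext h)))
        hcutS.comap (fun h => hhamS h.of_comap)
      exact ⟨t, k, _, hf.map (SimpleGraph.Embedding.comap (Function.Embedding.subtype (· ∈ S)) G)⟩
    · push Not at h
      exact IsMinimalNonhamiltonian.exists_isBrousekData ⟨hclaw, hcut, hham, h⟩

section Hamiltonian

variable {V : Type*} [DecidableEq V] {G : SimpleGraph V}

theorem SpanPath.exists_walk {S : Finset V} {a b : V} (h : SpanPath G S a b) :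
    ∃ p : G.Walk a b, p.IsPath ∧ ∀ x, x ∈ p.support ↔ x ∈ S := by
  induction h with
  | single a => exact ⟨.nil, by simp, by simp⟩
  | cons hx hxa _ ih =>
    obtain ⟨p, hp, hpS⟩ := ih
    refine ⟨.cons hxa p, ?_, fun y => by simp [hpS]⟩
    rw [SimpleGraph.Walk.cons_isPath_iff, hpS]
    exact ⟨hp, hx⟩

variable [Fintype V]

theorem SpanCycle.isHamiltonian (h : SpanCycle G Finset.univ) : G.IsHamiltonian := by
  intro _
  obtain ⟨x, -⟩ := Finset.card_pos.1 (show 0 < (Finset.univ : Finset V).card by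
    have := h.1
    omega)
  obtain ⟨y, z, hyz, hy, hz, hp⟩ := h.rotate (Finset.mem_univ x)
  obtain ⟨p, hpath, hsupp⟩ := hp.exists_walk
  have hx : x ∉ p.support := by simp [hsupp]
  have hpath' : (p.concat hz.symm).IsPath := hpath.concat hx hz.symm
  refine ⟨x, .cons hy (p.concat hz.symm), ?_⟩
  rw [SimpleGraph.Walk.isHamiltonianCycle_iff_isCycle_and_support_count_tail_eq_one]
  constructor
  · rw [SimpleGraph.Walk.cons_isCycle_iff]
    refine ⟨hpath', fun he => ?_⟩
    rw [SimpleGraph.Walk.edges_concat, List.concat_eq_append, List.mem_append,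
      List.mem_singleton] at he
    rcases he with he | he
    · exact hx (p.fst_mem_support_of_mem_edges he)
    · rw [Sym2.eq_swap, Sym2.eq_iff] at he
      rcases he with ⟨h, -⟩ | ⟨h, -⟩
      exacts [hyz h, hy.ne h.symm]
  · intro a
    rw [SimpleGraph.Walk.support_cons, List.tail_cons]
    refine List.count_eq_one_of_mem hpath'.support_nodup ?_
    rw [SimpleGraph.Walk.support_concat, List.mem_append,
      List.mem_singleton, hsupp]
    simpa using ne_or_eq a x

theorem TwoConnected.noCutVertex (h : TwoConnected G) : NoCutVertex G Finset.univ := by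
  refine ⟨by simpa using h.1, fun v _ X hX ⟨a, ha⟩ hcl c _ hcv => ?_⟩
  have hreach := (h.2 v).preconnected ⟨a, (hX a ha).2⟩ ⟨c, hcv⟩
  obtain ⟨p⟩ := hreach
  have : ∀ {x y : ({v}ᶜ : Set V)}, (G.induce ({v}ᶜ : Set V)).Walk x y → (x : V) ∈ X →
      (y : V) ∈ X := by
    intro x y p
    induction p with
    | nil => exact id
    | @cons x y z hxy _ ih => exact fun hx => ih (hcl x hx y (Finset.mem_univ _) y.2 hxy)
  exact this p ha

end Hamiltonian

/-- Brousek: every non-hamiltonian 2-connected claw-free graph contains an induced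
subgraph isomorphic to a member of the family `𝒫`. -/
theorem stmt_14 {V : Type*} [Fintype V] [DecidableEq V] (G : SimpleGraph V)
    (h2conn : TwoConnected G) (hclaw : ClawFree G) (hham : ¬ G.IsHamiltonian) :
    ∃ s : Set V, IsBrousekMember (G.induce s) := by
  obtain ⟨t, k, f, hf⟩ := exists_isBrousekData_of_card _ G rfl hclaw h2conn.noCutVertex
    fun h => hham h.isHamiltonian
  exact hf.exists_isBrousekMember
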